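/- Let p : ℝ^n → [1,∞) be measurable with p_+ < ∞ and suppose p(·) satisfies the A_∞ condition. Then there exist η, δ ∈ (0,1) and a function b from the set of all axis-parallel cubes to [0,1] such that: (i) for every cube Q, every measurable subset E ⊆ Q with |E| ≥ η|Q|, and every t ∈ (0, 1/‖χ_Q‖_{p(·)}], one has ∫_Q t^{p(x)} dx ≤ 2( ∫_E t^{p(x)} dx + t^δ b(Q) 1_{(0,1)}(t) ); and (ii) ∑_{Q∈F} b(Q) ≤ 1 for every family F of pairwise disjoint cubes. -/

import Mathlib

open MeasureTheory ENNReal Set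

noncomputable section

/-- An axis-parallel cube in `ℝⁿ`, given by its center and (positive) side length. -/
structure RCube (n : ℕ) where
  center : Fin n → ℝ
  side : ℝ
  side_pos : 0 < side

namespace RCube

/-- The (closed) cube as a subset of `ℝⁿ`. -/
def toSet {n : ℕ} (Q : RCube n) : Set (Fin n → ℝ) :=
  {x | ∀ i, |x i - Q.center i| ≤ Q.side / 2}

/-- `rQ`: the cube concentric with `Q` whose side length is `r` times that of `Q`. -/
def scaledSet {n : ℕ} (Q : RCube n) (r : ℝ) : Set (Fin n → ℝ) :=
  {x | ∀ i, |x i - Q.center i| ≤ r * Q.side / 2}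

end RCube

/-- A family of pairwise disjoint cubes. -/
def PairwiseDisjointCubes {n : ℕ} (F : Set (RCube n)) : Prop :=
  F.Pairwise fun Q₁ Q₂ => Disjoint Q₁.toSet Q₂.toSet

/-- The variable Lebesgue norm `‖f‖_{p(·)}` for a real-valued (finite) exponent,
applied to an `ℝ≥0∞`-valued function: `inf {λ > 0 : ∫ (f/λ)^{p(x)} dx ≤ 1}`. -/
def vnorm {n : ℕ} (p : (Fin n → ℝ) → ℝ) (f : (Fin n → ℝ) → ℝ≥0∞) : ℝ≥0∞ :=
  sInf {lam : ℝ≥0∞ | 0 < lam ∧ (∫⁻ x, (f x / lam) ^ p x) ≤ 1}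

/-- `t^e` for `t, e ∈ [0,∞]`, with the standard variable-exponent convention
`t^∞ = 0` for `t ≤ 1` and `t^∞ = ∞` for `t > 1`. -/
def epow (t e : ℝ≥0∞) : ℝ≥0∞ :=
  if e = ∞ then (if t ≤ 1 then 0 else ∞) else t ^ e.toReal

/-- The variable Lebesgue norm for an exponent with values in `[1,∞]`. -/
def vnormE {n : ℕ} (p : (Fin n → ℝ) → ℝ≥0∞) (f : (Fin n → ℝ) → ℝ≥0∞) : ℝ≥0∞ :=
  sInf {lam : ℝ≥0∞ | 0 < lam ∧ (∫⁻ x, epow (f x / lam) (p x)) ≤ 1}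

/-- `|f|` as an `ℝ≥0∞`-valued function. -/
def ofR {n : ℕ} (f : (Fin n → ℝ) → ℝ) : (Fin n → ℝ) → ℝ≥0∞ :=
  fun x => ENNReal.ofReal |f x|

/-- The `ℝ≥0∞`-valued characteristic function of a set. -/
def chiE {n : ℕ} (S : Set (Fin n → ℝ)) : (Fin n → ℝ) → ℝ≥0∞ :=
  S.indicator fun _ => 1

/-- The Hardy--Littlewood maximal operator (over axis-parallel cubes containing `x`). -/
def hlMaximal {n : ℕ} (f : (Fin n → ℝ) → ℝ) (x : Fin n → ℝ) : ℝ≥0∞ :=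
  ⨆ (Q : RCube n) (_ : x ∈ Q.toSet),
    (∫⁻ y in Q.toSet, ENNReal.ofReal |f y|) / volume Q.toSet

/-- `M` is bounded on `L^{p(·)}`: there is `C > 0` with `‖Mf‖_{p(·)} ≤ C ‖f‖_{p(·)}`
for every `f ∈ L^{p(·)}`. -/
def MaximalBounded {n : ℕ} (p : (Fin n → ℝ) → ℝ) : Prop :=
  ∃ C > (0 : ℝ), ∀ f : (Fin n → ℝ) → ℝ, Measurable f → vnorm p (ofR f) < ∞ →
    vnorm p (hlMaximal f) ≤ ENNReal.ofReal C * vnorm p (ofR f)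

/-- The function `∑_{Q ∈ F} t_Q χ_{E_Q}` (for a pairwise disjoint family,
written as a pointwise supremum). -/
def cubeSum {n : ℕ} (F : Set (RCube n)) (t : RCube n → ℝ)
    (E : RCube n → Set (Fin n → ℝ)) (x : Fin n → ℝ) : ℝ≥0∞ :=
  ⨆ (Q : RCube n) (_ : Q ∈ F) (_ : x ∈ E Q), ENNReal.ofReal (t Q)

/-- `p(·)` satisfies the `A_∞` condition with parameter `lam` and constant `C`. -/
def AInftyWith {n : ℕ} (p : (Fin n → ℝ) → ℝ) (lam C : ℝ) : Prop :=
  ∀ F : Set (RCube n), PairwiseDisjointCubes F →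
    ∀ t : RCube n → ℝ, (∀ Q ∈ F, 0 ≤ t Q) →
      ∀ E : RCube n → Set (Fin n → ℝ),
        (∀ Q ∈ F, MeasurableSet (E Q) ∧ E Q ⊆ Q.toSet ∧
          ENNReal.ofReal lam * volume Q.toSet ≤ volume (E Q)) →
        vnorm p (cubeSum F t RCube.toSet) ≤ ENNReal.ofReal C * vnorm p (cubeSum F t E)

/-- The `A_∞` condition for a real-valued exponent. -/
def AInfty {n : ℕ} (p : (Fin n → ℝ) → ℝ) : Prop :=
  ∃ lam ∈ Ioo (0 : ℝ) 1, ∃ C > (0 : ℝ), AInftyWith p lam C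

/-- `p(·)` satisfies the `A_∞` condition with parameter `lam` and constant `C`
(exponent with values in `[1,∞]`). -/
def AInftyWithE {n : ℕ} (p : (Fin n → ℝ) → ℝ≥0∞) (lam C : ℝ) : Prop :=
  ∀ F : Set (RCube n), PairwiseDisjointCubes F →
    ∀ t : RCube n → ℝ, (∀ Q ∈ F, 0 ≤ t Q) →
      ∀ E : RCube n → Set (Fin n → ℝ),
        (∀ Q ∈ F, MeasurableSet (E Q) ∧ E Q ⊆ Q.toSet ∧
          ENNReal.ofReal lam * volume Q.toSet ≤ volume (E Q)) →
        vnormE p (cubeSum F t RCube.toSet) ≤ ENNReal.ofReal C * vnormE p (cubeSum F t E)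

/-- The `A_∞` condition for an exponent with values in `[1,∞]`. -/
def AInftyE {n : ℕ} (p : (Fin n → ℝ) → ℝ≥0∞) : Prop :=
  ∃ lam ∈ Ioo (0 : ℝ) 1, ∃ C > (0 : ℝ), AInftyWithE p lam C

/-- The nonincreasing-rearrangement value `(f χ_Q)^*(s) = inf {α : |{x ∈ Q : |f x| > α}| ≤ s}`. -/
def rearr {n : ℕ} (f : (Fin n → ℝ) → ℝ) (Q : RCube n) (s : ℝ≥0∞) : ℝ≥0∞ :=
  sInf {a : ℝ≥0∞ | volume {x | x ∈ Q.toSet ∧ a < ENNReal.ofReal |f x|} ≤ s}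

/-- The `λ`-median maximal operator `m_λ`. -/
def medianMax {n : ℕ} (lam : ℝ) (f : (Fin n → ℝ) → ℝ) (x : Fin n → ℝ) : ℝ≥0∞ :=
  ⨆ (Q : RCube n) (_ : x ∈ Q.toSet), rearr f Q (ENNReal.ofReal lam * volume Q.toSet)

/-- The modified median maximal operator `m_{τ,r}` (supremum over cubes `Q` with `x ∈ rQ`). -/
def medianMaxR {n : ℕ} (tau r : ℝ) (f : (Fin n → ℝ) → ℝ) (x : Fin n → ℝ) : ℝ≥0∞ :=
  ⨆ (Q : RCube n) (_ : x ∈ Q.scaledSet r), rearr f Q (ENNReal.ofReal tau * volume Q.toSet)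

/-- The average `⟨f⟩_Q = (1/|Q|) ∫_Q f`. -/
def cubeAvg {n : ℕ} (f : (Fin n → ℝ) → ℝ) (Q : RCube n) : ℝ :=
  (∫ y in Q.toSet, f y) / (volume Q.toSet).toReal

/-- `|T_F f|` for a pairwise disjoint family `F`, written as a pointwise supremum. -/
def avgSum {n : ℕ} (F : Set (RCube n)) (f : (Fin n → ℝ) → ℝ) (x : Fin n → ℝ) : ℝ≥0∞ :=
  ⨆ (Q : RCube n) (_ : Q ∈ F) (_ : x ∈ Q.toSet), ENNReal.ofReal |cubeAvg f Q|

/-- The reverse Hölder condition `RH`. -/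
def RHCond {n : ℕ} (p : (Fin n → ℝ) → ℝ) : Prop :=
  ∃ r : ℝ, 1 < r ∧ ∃ C : ℝ, 0 < C ∧
    ∀ S : Set (RCube n), PairwiseDisjointCubes S →
      ∀ t : RCube n → ℝ, (∀ Q ∈ S, 0 ≤ t Q) →
        (∑' Q : S, ∫⁻ x in Q.1.toSet, ENNReal.ofReal (t Q.1) ^ p x) ≤ 1 →
        (∑' Q : S, volume Q.1.toSet *
            ((∫⁻ x in Q.1.toSet, ENNReal.ofReal (t Q.1) ^ (r * p x)) / volume Q.1.toSet)
              ^ (1 / r)) ≤ ENNReal.ofReal C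


/-- The modular of `t χ_S`. -/
def modI {n : ℕ} (p : (Fin n → ℝ) → ℝ) (S : Set (Fin n → ℝ)) (t : ℝ) : ℝ≥0∞ :=
  ∫⁻ x in S, ENNReal.ofReal t ^ p x

theorem modI_mono {n : ℕ} (p : (Fin n → ℝ) → ℝ) {S S' : Set (Fin n → ℝ)} (h : S ⊆ S') (t : ℝ) :
    modI p S t ≤ modI p S' t := lintegral_mono_set h

theorem rpow_meas {n : ℕ} {p : (Fin n → ℝ) → ℝ} (hpm : Measurable p) (t : ℝ≥0∞) :
    Measurable (fun x => t ^ p x) := by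
  fun_prop

theorem modI_upper {n : ℕ} {p : (Fin n → ℝ) → ℝ} (hpm : Measurable p) (hp1 : ∀ x, 1 ≤ p x)
    (S : Set (Fin n → ℝ)) {m t : ℝ} (hm0 : 0 < m) (hm1 : m ≤ 1) :
    modI p S (m * t) ≤ ENNReal.ofReal m * modI p S t := by
  unfold modI
  rw [← lintegral_const_mul _ (rpow_meas hpm _)]
  refine lintegral_mono fun x => ?_
  simp only
  rw [ENNReal.ofReal_mul hm0.le, ENNReal.mul_rpow_of_nonneg _ _ (by linarith [hp1 x])]
  gcongr
  calc ENNReal.ofReal m ^ p x ≤ ENNReal.ofReal m ^ (1:ℝ) :=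
        ENNReal.rpow_le_rpow_of_exponent_ge (by simpa using hm1) (hp1 x)
    _ = _ := by simp

theorem modI_lower {n : ℕ} {p : (Fin n → ℝ) → ℝ} (hpm : Measurable p) (hp1 : ∀ x, 1 ≤ p x)
    {B : ℝ} (hB : ∀ᵐ x ∂(volume : Measure (Fin n → ℝ)), p x ≤ B)
    (S : Set (Fin n → ℝ)) {m t : ℝ} (hm0 : 0 < m) (hm1 : m ≤ 1) :
    ENNReal.ofReal m ^ B * modI p S t ≤ modI p S (m * t) := by
  unfold modI
  rw [← lintegral_const_mul _ (rpow_meas hpm _)]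
  refine lintegral_mono_ae ?_
  filter_upwards [ae_restrict_of_ae hB] with x hx
  rw [ENNReal.ofReal_mul hm0.le, ENNReal.mul_rpow_of_nonneg _ _ (by linarith [hp1 x])]
  gcongr ?_ * _
  exact ENNReal.rpow_le_rpow_of_exponent_ge (by simpa using hm1) hx

theorem toSet_eq {n : ℕ} (Q : RCube n) : Q.toSet = Metric.closedBall Q.center (Q.side / 2) := by
  have := Q.side_pos
  ext x
  rw [closedBall_pi _ (by positivity)]
  simp [RCube.toSet, Real.dist_eq]

theorem toSet_meas {n : ℕ} (Q : RCube n) : MeasurableSet Q.toSet := by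
  rw [toSet_eq]; exact Metric.isClosed_closedBall.measurableSet

theorem volume_toSet {n : ℕ} (Q : RCube n) : volume Q.toSet = ENNReal.ofReal (Q.side ^ n) := by
  have := Q.side_pos
  rw [toSet_eq, Real.volume_pi_closedBall _ (by positivity)]
  simp; congr 2; ring

theorem volume_toSet_ne_top {n : ℕ} (Q : RCube n) : volume Q.toSet ≠ ∞ := by
  rw [volume_toSet]; simp

theorem volume_toSet_ne_zero {n : ℕ} (Q : RCube n) : volume Q.toSet ≠ 0 := by
  have := Q.side_pos
  rw [volume_toSet]; simp; positivity

theorem center_mem {n : ℕ} (Q : RCube n) : Q.center ∈ Q.toSet := by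
  have := Q.side_pos
  intro i; simp; positivity

/-- value of `cubeSum` integrals -/
theorem lintegral_cubeSum {n : ℕ} {p : (Fin n → ℝ) → ℝ} (hpm : Measurable p) (hp1 : ∀ x, 1 ≤ p x)
    {ι : Type} [Countable ι] (Q : ι → RCube n)
    (t : RCube n → ℝ) (E : RCube n → Set (Fin n → ℝ)) (hE : ∀ i, MeasurableSet (E (Q i)))
    (hd : Pairwise (Function.onFun Disjoint fun i => E (Q i))) :
    ∫⁻ x, cubeSum (range Q) t E x ^ p x = ∑' i, modI p (E (Q i)) (t (Q i)) := by
  have h1 : ∀ i, modI p (E (Q i)) (t (Q i)) =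
      ∫⁻ x, (E (Q i)).indicator (fun x => ENNReal.ofReal (t (Q i)) ^ p x) x := by
    intro i
    rw [lintegral_indicator (hE i)]; rfl
  simp_rw [h1]
  rw [← lintegral_tsum (fun i => ((rpow_meas hpm _).indicator (hE i)).aemeasurable)]
  refine lintegral_congr fun x => ?_
  have hc : cubeSum (range Q) t E x = ⨆ (i : ι) (_ : x ∈ E (Q i)), ENNReal.ofReal (t (Q i)) := by
    unfold cubeSum
    apply le_antisymm
    · refine iSup_le fun R => iSup_le fun hR => iSup_le fun hx => ?_
      obtain ⟨i, rfl⟩ := hR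
      exact le_iSup₂_of_le i hx le_rfl
    · refine iSup₂_le fun i hx => ?_
      exact le_iSup_of_le (Q i) (le_iSup₂_of_le ⟨i, rfl⟩ hx le_rfl)
  rw [hc]
  by_cases hx : ∃ i, x ∈ E (Q i)
  · obtain ⟨i, hi⟩ := hx
    have hu : ∀ j, j ≠ i → x ∉ E (Q j) := fun j hj hxj =>
      Set.disjoint_left.1 (hd hj) hxj hi
    rw [tsum_eq_single i (fun j hj => by simp [hu j hj])]
    rw [indicator_of_mem hi]
    congr 1
    apply le_antisymm
    · refine iSup₂_le fun j hj => ?_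
      by_cases hji : j = i
      · rw [hji]
      · exact absurd hj (hu j hji)
    · exact le_iSup₂_of_le i hi le_rfl
  · push Not at hx
    simp [hx]
    linarith [hp1 x]

theorem vnorm_lower {n : ℕ} {p : (Fin n → ℝ) → ℝ} (hp1 : ∀ x, 1 ≤ p x)
    (f : (Fin n → ℝ) → ℝ≥0∞) (h : 1 / 2 < ∫⁻ x, f x ^ p x) : 1 / 2 ≤ vnorm p f := by
  refine le_sInf ?_
  rintro lam ⟨h0, h1⟩
  by_contra! hl
  have hlt : lam ≠ ∞ := ne_top_of_lt hl
  have : ∫⁻ x, f x ^ p x ≤ lam := by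
    calc ∫⁻ x, f x ^ p x ≤ ∫⁻ x, lam * (f x / lam) ^ p x := by
          refine lintegral_mono fun x => ?_
          simp only
          conv_lhs => rw [← ENNReal.mul_div_cancel (a := lam) (b := f x) h0.ne' hlt]
          rw [ENNReal.mul_rpow_of_nonneg _ _ (by linarith [hp1 x])]
          gcongr
          calc lam ^ p x ≤ lam ^ (1:ℝ) :=
              ENNReal.rpow_le_rpow_of_exponent_ge (hl.le.trans (by simp)) (hp1 x)
            _ = _ := by simp
      _ = lam * ∫⁻ x, (f x / lam) ^ p x := lintegral_const_mul' _ _ hlt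
      _ ≤ lam * 1 := by gcongr
      _ = lam := by simp
  exact absurd (h.trans_le this) (not_lt.2 hl.le)

theorem vnorm_upper {n : ℕ} {p : (Fin n → ℝ) → ℝ} (hp1 : ∀ x, 1 ≤ p x)
    {B : ℝ} (hB : ∀ᵐ x ∂(volume : Measure (Fin n → ℝ)), p x ≤ B)
    (f : (Fin n → ℝ) → ℝ≥0∞) {m : ℝ≥0∞} (hm0 : 0 < m) (hm1 : m ≤ 1) (h : m < vnorm p f) :
    m ^ B ≤ ∫⁻ x, f x ^ p x := by
  have hmt : m ≠ ∞ := ne_top_of_le_ne_top one_ne_top hm1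
  have h1 : 1 < ∫⁻ x, (f x / m) ^ p x := by
    by_contra! hc
    exact absurd h (not_lt.2 (sInf_le ⟨hm0, hc⟩))
  calc m ^ B = m ^ B * 1 := by simp
    _ ≤ m ^ B * ∫⁻ x, (f x / m) ^ p x := by gcongr
    _ = ∫⁻ x, m ^ B * (f x / m) ^ p x := by
        rw [lintegral_const_mul']
        exact ENNReal.rpow_ne_top_of_ne_zero hm0.ne' hmt
    _ ≤ _ := by
        refine lintegral_mono_ae ?_
        filter_upwards [hB] with x hx
        conv_rhs => rw [← ENNReal.mul_div_cancel (a := m) (b := f x) hm0.ne' hmt]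
        rw [ENNReal.mul_rpow_of_nonneg _ _ (by linarith [hp1 x])]
        gcongr ?_ * _
        exact ENNReal.rpow_le_rpow_of_exponent_ge hm1 hx

theorem stepA {n : ℕ} {p : (Fin n → ℝ) → ℝ} (hpm : Measurable p)
    (hp1 : ∀ x, 1 ≤ p x)
    {B : ℝ} (hB1 : 1 ≤ B) (hB : ∀ᵐ x ∂(volume : Measure (Fin n → ℝ)), p x ≤ B)
    (hA : AInfty p) :
    ∃ κ ∈ Ioo (0:ℝ) 1, ∃ ρ ∈ Ioo (0:ℝ) 1, ∀ (ι : Type) [Countable ι] (Q : ι → RCube n) (t : ι → ℝ)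
      (F : ι → Set (Fin n → ℝ)), Pairwise (Function.onFun Disjoint fun i => (Q i).toSet) →
      (∀ i, 0 ≤ t i) → (∀ i, MeasurableSet (F i)) → (∀ i, F i ⊆ (Q i).toSet) →
      (∀ i, volume (F i) ≤ ENNReal.ofReal κ * volume (Q i).toSet) →
      ∑' i, modI p (Q i).toSet (t i) ≤ 1 → ∑' i, modI p (F i) (t i) ≤ ENNReal.ofReal ρ := by
  obtain ⟨lam, ⟨hl0, hl1⟩, C, hC, hA⟩ := hA
  set m : ℝ := 1 / (4 * (C + 1)) with hm
  have hm0 : 0 < m := by positivity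
  have hm1 : m < 1 := by rw [hm, div_lt_one (by positivity)]; linarith
  have hmB0 : 0 < m ^ B := by positivity
  have hmB1 : m ^ B < 1 := Real.rpow_lt_one hm0.le hm1 (by linarith)
  refine ⟨1 - lam, ⟨by linarith, by linarith⟩, max (1/2) (1 - m ^ B),
    ⟨by positivity, max_lt (by norm_num) (by linarith)⟩, ?_⟩
  intro ι _ Q t F hd ht hFm hFs hFv hsum
  have hinj : Function.Injective Q := by
    intro i j hij
    by_contra hne
    have := hd hne
    simp only [Function.onFun] at this
    rw [hij] at this
    exact Set.disjoint_left.1 this (center_mem _) (center_mem _)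
  have hmono : ∑' i, modI p (F i) (t i) ≤ ∑' i, modI p (Q i).toSet (t i) :=
    ENNReal.tsum_le_tsum fun i => modI_mono p (hFs i) _
  by_cases hM : ∑' i, modI p (Q i).toSet (t i) ≤ 1 / 2
  · refine (hmono.trans hM).trans ?_
    calc (1:ℝ≥0∞) / 2 = ENNReal.ofReal (1/2) := by
          rw [ENNReal.ofReal_div_of_pos (by norm_num)]; simp
      _ ≤ _ := ENNReal.ofReal_le_ofReal (le_max_left _ _)
  push Not at hM
  set T : RCube n → ℝ := Function.extend Q t 0 with hT
  set E : RCube n → Set (Fin n → ℝ) := Function.extend Q (fun i => (Q i).toSet \ F i) (fun _ => ∅)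
    with hE
  have hTQ : ∀ i, T (Q i) = t i := fun i => hinj.extend_apply _ _ _
  have hEQ : ∀ i, E (Q i) = (Q i).toSet \ F i := fun i => hinj.extend_apply _ _ _
  have hEm : ∀ i, MeasurableSet (E (Q i)) := fun i => by
    rw [hEQ]; exact (toSet_meas _).diff (hFm i)
  have hEd : Pairwise (Function.onFun Disjoint fun i => E (Q i)) := by
    intro i j hij
    simp only [Function.onFun, hEQ]
    exact (hd hij).mono sdiff_subset sdiff_subset
  have key := hA (range Q) (by
      rintro _ ⟨i, rfl⟩ _ ⟨j, rfl⟩ hne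
      exact hd (fun h => hne (by rw [h]))) T (by
      rintro _ ⟨i, rfl⟩; rw [hTQ]; exact ht i) E (by
      rintro _ ⟨i, rfl⟩
      refine ⟨hEm i, by rw [hEQ]; exact sdiff_subset, ?_⟩
      rw [hEQ, measure_sdiff (hFs i) (hFm i).nullMeasurableSet
        (ne_top_of_le_ne_top (volume_toSet_ne_top _) (measure_mono (hFs i)))]
      refine ENNReal.le_sub_of_add_le_right
        (ne_top_of_le_ne_top (volume_toSet_ne_top _) (measure_mono (hFs i))) ?_
      calc _ ≤ ENNReal.ofReal lam * volume (Q i).toSet +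
            ENNReal.ofReal (1 - lam) * volume (Q i).toSet := by gcongr; exact hFv i
        _ = volume (Q i).toSet := by
            rw [← add_mul, ← ENNReal.ofReal_add hl0.le (by linarith)]; simp)
  have e1 := lintegral_cubeSum hpm hp1 Q T RCube.toSet (fun i => toSet_meas _) hd
  have e2 := lintegral_cubeSum hpm hp1 Q T E hEm hEd
  simp only [hTQ] at e1 e2
  have k1 := vnorm_lower hp1 _ (hM.trans_eq e1.symm)
  have k2 : ENNReal.ofReal m < vnorm p (cubeSum (range Q) T E) := by
    by_contra! hc
    have : (1:ℝ≥0∞) / 2 ≤ ENNReal.ofReal (C * m) := by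
      rw [ENNReal.ofReal_mul hC.le]
      exact k1.trans (key.trans (by gcongr))
    have h2 : (1:ℝ≥0∞) / 2 = ENNReal.ofReal (1/2) := by
          rw [ENNReal.ofReal_div_of_pos (by norm_num)]; simp
    rw [h2, ENNReal.ofReal_le_ofReal_iff (by positivity)] at this
    have : C * m < 1 / 2 := by
      rw [hm, mul_one_div, div_lt_div_iff₀ (by positivity) (by norm_num)]; linarith
    linarith
  have k3 := vnorm_upper hp1 hB _ (by simpa using hm0) (by simpa using hm1.le) k2
  rw [e2, ENNReal.ofReal_rpow_of_pos hm0] at k3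
  have hsplit : ∑' i, modI p (F i) (t i) + ∑' i, modI p (E (Q i)) (t i) =
      ∑' i, modI p (Q i).toSet (t i) := by
    rw [← ENNReal.tsum_add]
    refine tsum_congr fun i => ?_
    unfold modI
    rw [hEQ, ← lintegral_union ((toSet_meas _).diff (hFm i)) disjoint_sdiff_right,
      union_sdiff_cancel (hFs i)]
  calc _ ≤ 1 - ENNReal.ofReal (m ^ B) := by
        refine ENNReal.le_sub_of_add_le_right (by simp) ?_
        calc _ ≤ _ := by gcongr
          _ = _ := hsplit
          _ ≤ 1 := hsum
    _ = ENNReal.ofReal (1 - m ^ B) := by rw [ENNReal.ofReal_sub _ hmB0.le]; simp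
    _ ≤ _ := ENNReal.ofReal_le_ofReal (le_max_right _ _)

/-- contraction for disjoint closed cubes -/
theorem stepS {n : ℕ} {p : (Fin n → ℝ) → ℝ} (hpm : Measurable p)
    (hp1 : ∀ x, 1 ≤ p x)
    {B : ℝ} (hB1 : 1 ≤ B) (hB : ∀ᵐ x ∂(volume : Measure (Fin n → ℝ)), p x ≤ B)
    (hA : AInfty p) :
    ∃ κ ∈ Ioo (0:ℝ) 1, ∃ γ ∈ Ioo (0:ℝ) 1, ∀ (ι : Type) [Countable ι] (Q : ι → RCube n) (t : ι → ℝ)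
      (F : ι → Set (Fin n → ℝ)), Pairwise (Function.onFun Disjoint fun i => (Q i).toSet) →
      (∀ i, 0 ≤ t i) → (∀ i, MeasurableSet (F i)) → (∀ i, F i ⊆ (Q i).toSet) →
      (∀ i, volume (F i) ≤ ENNReal.ofReal κ * volume (Q i).toSet) →
      ∑' i, modI p (Q i).toSet (t i) ≤ 1 → ∑' i, modI p (F i) (t i / γ) ≤ 1 := by
  obtain ⟨κ, hκ, ρ, ⟨hρ0, hρ1⟩, h⟩ := stepA hpm hp1 hB1 hB hA
  refine ⟨κ, hκ, ρ ^ (1 / B), ⟨by positivity, Real.rpow_lt_one hρ0.le hρ1 (by positivity)⟩, ?_⟩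
  intro ι _ Q t F hd ht hFm hFs hFv hsum
  have h1 := h ι Q t F hd ht hFm hFs hFv hsum
  set γ := ρ ^ (1 / B) with hγ
  have hγ0 : 0 < γ := by positivity
  have hγ1 : γ ≤ 1 := (Real.rpow_lt_one hρ0.le hρ1 (by positivity)).le
  have hγB : ENNReal.ofReal γ ^ B = ENNReal.ofReal ρ := by
    rw [ENNReal.ofReal_rpow_of_pos hγ0, hγ, ← Real.rpow_mul hρ0.le]
    congr 1
    rw [one_div_mul_cancel (by linarith), Real.rpow_one]
  have h2 : ENNReal.ofReal ρ * ∑' i, modI p (F i) (t i / γ) ≤ ENNReal.ofReal ρ * 1 := by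
    rw [← ENNReal.tsum_mul_left, mul_one]
    refine le_trans (ENNReal.tsum_le_tsum fun i => ?_) h1
    have := modI_lower hpm hp1 hB (F i) (t := t i / γ) hγ0 hγ1
    rwa [hγB, mul_div_cancel₀ _ hγ0.ne'] at this
  exact (ENNReal.mul_le_mul_iff_right (by simpa using hρ0) (by simp)).1 h2


/-- half-open version of a cube -/
def hoSet {n : ℕ} (Q : RCube n) : Set (Fin n → ℝ) :=
  Set.univ.pi fun i => Ico (Q.center i - Q.side / 2) (Q.center i + Q.side / 2)

theorem hoSet_meas {n : ℕ} (Q : RCube n) : MeasurableSet (hoSet Q) :=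
  MeasurableSet.univ_pi fun _ => measurableSet_Ico

theorem hoSet_subset {n : ℕ} (Q : RCube n) : hoSet Q ⊆ Q.toSet := by
  intro x hx i
  have := hx i (mem_univ i)
  rw [abs_le]
  constructor <;> linarith [this.1, this.2]

theorem volume_hoSet {n : ℕ} (Q : RCube n) : volume (hoSet Q) = volume Q.toSet := by
  rw [hoSet, Real.volume_pi_Ico, volume_toSet]
  simp
  rw [ENNReal.ofReal_pow Q.side_pos.le]

theorem hoSet_ae {n : ℕ} (Q : RCube n) :
    (hoSet Q : Set (Fin n → ℝ)) =ᵐ[volume] Q.toSet :=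
  ae_eq_of_subset_of_measure_ge (hoSet_subset Q) (volume_hoSet Q).ge
    (hoSet_meas Q).nullMeasurableSet (volume_toSet_ne_top Q)

theorem modI_congr {n : ℕ} (p : (Fin n → ℝ) → ℝ) {S S' : Set (Fin n → ℝ)}
    (h : S =ᵐ[volume] S') (t : ℝ) : modI p S t = modI p S' t := by
  unfold modI; rw [Measure.restrict_congr_set h]

/-- the concentric cube of side `r * side` -/
def shrink {n : ℕ} (Q : RCube n) (r : ℝ) (hr : 0 < r) : RCube n :=
  ⟨Q.center, r * Q.side, mul_pos hr Q.side_pos⟩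

theorem shrink_subset {n : ℕ} (Q : RCube n) {r : ℝ} (hr : 0 < r) (hr1 : r < 1) :
    (shrink Q r hr).toSet ⊆ hoSet Q := by
  intro x hx i _
  have h1 := hx i
  have := Q.side_pos
  simp only [shrink] at h1
  rw [abs_le] at h1
  have h2 : r * Q.side < Q.side := by nlinarith
  constructor <;> linarith [h1.1, h1.2]

theorem volume_shrink {n : ℕ} (Q : RCube n) {r : ℝ} (hr : 0 < r) :
    volume (shrink Q r hr).toSet = ENNReal.ofReal (r ^ n) * volume Q.toSet := by
  rw [volume_toSet, volume_toSet, ← ENNReal.ofReal_mul (by positivity)]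
  simp [shrink, mul_pow]

theorem modI_zero {n : ℕ} {p : (Fin n → ℝ) → ℝ} {S : Set (Fin n → ℝ)} (hS : volume S = 0) (t : ℝ) :
    modI p S t = 0 := by
  unfold modI
  rw [Measure.restrict_eq_zero.2 hS]; simp

/-- contraction for disjoint half-open cubes -/
theorem stepH {n : ℕ} {p : (Fin n → ℝ) → ℝ} (hpm : Measurable p)
    (hp1 : ∀ x, 1 ≤ p x)
    {B : ℝ} (hB1 : 1 ≤ B) (hB : ∀ᵐ x ∂(volume : Measure (Fin n → ℝ)), p x ≤ B)
    (hA : AInfty p) :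
    ∃ κ ∈ Ioo (0:ℝ) 1, ∃ γ ∈ Ioo (0:ℝ) 1, ∀ (ι : Type) [Countable ι] (Q : ι → RCube n) (t : ι → ℝ)
      (F : ι → Set (Fin n → ℝ)), Pairwise (Function.onFun Disjoint fun i => hoSet (Q i)) →
      (∀ i, 0 ≤ t i) → (∀ i, MeasurableSet (F i)) → (∀ i, F i ⊆ hoSet (Q i)) →
      (∀ i, volume (F i) ≤ ENNReal.ofReal κ * volume (Q i).toSet) →
      ∑' i, modI p (hoSet (Q i)) (t i) ≤ 1 → ∑' i, modI p (F i) (t i / γ) ≤ 1 := by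
  obtain ⟨κ, ⟨hκ0, hκ1⟩, γ, hγ, h⟩ := stepS hpm hp1 hB1 hB hA
  refine ⟨κ / 2, ⟨by linarith, by linarith⟩, γ, hγ, ?_⟩
  intro ι _ Q t F hd ht hFm hFs hFv hsum
  -- radii
  obtain ⟨u, hu_mono, hu_lt, hu_lim⟩ := exists_seq_strictMono_tendsto' (α := ℝ) (show (0:ℝ) < 1 by norm_num)
  have hpow : Filter.Tendsto (fun j => u j ^ n) Filter.atTop (nhds 1) := by
    simpa using hu_lim.pow n
  obtain ⟨N, hN⟩ := Filter.eventually_atTop.1 (hpow.eventually (lt_mem_nhds (show (1/2:ℝ) < 1 by norm_num)))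
  set r : ℕ → ℝ := fun j => u (N + j) with hr
  have hr0 : ∀ j, 0 < r j := fun j => (hu_lt _).1
  have hr1 : ∀ j, r j < 1 := fun j => (hu_lt _).2
  have hrm : Monotone r := fun a b hab => hu_mono.monotone (by omega)
  have hrp : ∀ j, 1 / 2 < r j ^ n := fun j => hN _ (by omega)
  have hrl : Filter.Tendsto r Filter.atTop (nhds 1) := by
    have := (Filter.tendsto_add_atTop_iff_nat N).2 hu_lim
    simpa [hr, add_comm] using this
  have hj : ∀ j, ∑' i, modI p (F i ∩ (shrink (Q i) (r j) (hr0 j)).toSet) (t i / γ) ≤ 1 := by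
    intro j
    refine h ι (fun i => shrink (Q i) (r j) (hr0 j)) t _ ?_ ht
      (fun i => (hFm i).inter (toSet_meas _)) (fun i => inter_subset_right) ?_ ?_
    · intro a b hab
      exact (hd hab).mono (shrink_subset _ _ (hr1 j)) (shrink_subset _ _ (hr1 j))
    · intro i
      refine (measure_mono inter_subset_left).trans ((hFv i).trans ?_)
      rw [volume_shrink, ← mul_assoc, ← ENNReal.ofReal_mul hκ0.le]
      gcongr
      nlinarith [hrp j]
    · refine le_trans (ENNReal.tsum_le_tsum fun i => ?_) hsum
      exact modI_mono p (shrink_subset _ _ (hr1 j)) _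
  have hmono : ∀ i, Monotone fun j => F i ∩ (shrink (Q i) (r j) (hr0 j)).toSet := by
    intro i a b hab
    refine inter_subset_inter_right _ ?_
    intro x hx k
    refine (hx k).trans ?_
    have := (Q i).side_pos
    have := hrm hab
    simp only [shrink]
    gcongr
  have hU : ∀ i, modI p (F i) (t i / γ) =
      ⨆ j, modI p (F i ∩ (shrink (Q i) (r j) (hr0 j)).toSet) (t i / γ) := by
    intro i
    have h1 : modI p (⋃ j, F i ∩ (shrink (Q i) (r j) (hr0 j)).toSet) (t i / γ) =
      ⨆ j, modI p (F i ∩ (shrink (Q i) (r j) (hr0 j)).toSet) (t i / γ) :=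
      setLIntegral_iUnion_of_directed _ (hmono i).directed_le
    rw [← h1]
    apply modI_congr
    have hz : volume (hoSet (Q i) \ ⋃ j, (shrink (Q i) (r j) (hr0 j)).toSet) = 0 := by
      have hb : ∀ j, volume (hoSet (Q i) \ ⋃ j, (shrink (Q i) (r j) (hr0 j)).toSet) ≤
          ENNReal.ofReal (1 - r j ^ n) * volume (Q i).toSet := by
        intro j
        have hp : r j ^ n ≤ 1 := pow_le_one₀ (hr0 j).le (hr1 j).le
        calc _ ≤ volume (hoSet (Q i) \ (shrink (Q i) (r j) (hr0 j)).toSet) :=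
              measure_mono (sdiff_subset_sdiff_right (subset_iUnion (fun j => (shrink (Q i) (r j) (hr0 j)).toSet) j))
          _ = volume (Q i).toSet - ENNReal.ofReal (r j ^ n) * volume (Q i).toSet := by
              rw [measure_sdiff (shrink_subset _ _ (hr1 j)) (toSet_meas _).nullMeasurableSet
                (volume_toSet_ne_top _), volume_hoSet, volume_shrink]
          _ ≤ _ := by
              rw [tsub_le_iff_right, ← add_mul, ← ENNReal.ofReal_add (by linarith) (by have := hr0 j; positivity)]
              simp
      have hl : Filter.Tendsto (fun j => ENNReal.ofReal (1 - r j ^ n) * volume (Q i).toSet)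
          Filter.atTop (nhds (ENNReal.ofReal 0 * volume (Q i).toSet)) := by
        refine ENNReal.Tendsto.mul_const (ENNReal.tendsto_ofReal ?_) (Or.inr (volume_toSet_ne_top _))
        have := (hrl.pow n).const_sub 1
        simpa using this
      have := ge_of_tendsto' hl hb
      simpa using this
    refine (ae_eq_of_subset_of_measure_ge (iUnion_subset fun j => inter_subset_left) ?_ ?_ ?_).symm
    · rw [← inter_iUnion]
      calc volume (F i) ≤ volume ((F i ∩ ⋃ j, (shrink (Q i) (r j) (hr0 j)).toSet) ∪
            (hoSet (Q i) \ ⋃ j, (shrink (Q i) (r j) (hr0 j)).toSet)) := by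
            refine measure_mono fun x hx => ?_
            by_cases hxu : x ∈ ⋃ j, (shrink (Q i) (r j) (hr0 j)).toSet
            · exact Or.inl ⟨hx, hxu⟩
            · exact Or.inr ⟨hFs i hx, hxu⟩
        _ ≤ _ := (measure_union_le _ _).trans (by rw [hz, add_zero])
    · exact (MeasurableSet.iUnion fun j => (hFm i).inter (toSet_meas _)).nullMeasurableSet
    · exact ne_top_of_le_ne_top (volume_toSet_ne_top (Q i))
        (measure_mono ((hFs i).trans (hoSet_subset _)))
  simp_rw [hU]
  rw [ENNReal.tsum_eq_iSup_sum]
  refine iSup_le fun s => ?_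
  rw [ENNReal.finsetSum_iSup_of_monotone]
  · exact iSup_le fun j => (ENNReal.sum_le_tsum s).trans (hj j)
  · intro i a b hab
    exact modI_mono p (hmono i hab) _


/-- dyadic subcubes -/
def dyad {n : ℕ} (Q : RCube n) (k : ℕ) (v : Fin n → ℤ) : RCube n where
  center := fun i => Q.center i - Q.side / 2 + Q.side * (v i + 1 / 2) / 2 ^ k
  side := Q.side / 2 ^ k
  side_pos := div_pos Q.side_pos (by positivity)

/-- index of the dyadic cube of level `k` containing `x` -/
def dIdx {n : ℕ} (Q : RCube n) (k : ℕ) (x : Fin n → ℝ) : Fin n → ℤ :=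
  fun i => ⌊2 ^ k * ((x i - (Q.center i - Q.side / 2)) / Q.side)⌋

theorem mem_dyad {n : ℕ} (Q : RCube n) (k : ℕ) (v : Fin n → ℤ) (x : Fin n → ℝ) :
    x ∈ hoSet (dyad Q k v) ↔ dIdx Q k x = v := by
  have hs := Q.side_pos
  have h2 : (0:ℝ) < 2 ^ k := by positivity
  rw [funext_iff]
  simp only [hoSet, Set.mem_univ_pi, dIdx, Int.floor_eq_iff, mem_Ico, dyad]
  refine forall_congr' fun i => and_congr ?_ ?_
  · rw [← mul_div_assoc, le_div_iff₀ hs]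
    have : Q.center i - Q.side / 2 + Q.side * (v i + 1 / 2) / 2 ^ k - Q.side / 2 ^ k / 2 =
      (Q.center i - Q.side / 2) + (v i * Q.side) / 2 ^ k := by ring
    rw [this, ← le_sub_iff_add_le', div_le_iff₀ h2, mul_comm (2 ^ k)]
  · rw [← mul_div_assoc, div_lt_iff₀ hs]
    have : Q.center i - Q.side / 2 + Q.side * (v i + 1 / 2) / 2 ^ k + Q.side / 2 ^ k / 2 =
      (Q.center i - Q.side / 2) + ((v i + 1) * Q.side) / 2 ^ k := by ring
    rw [this, ← sub_lt_iff_lt_add', lt_div_iff₀ h2, mul_comm (2 ^ k)]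

theorem dIdx_anc {n : ℕ} (Q : RCube n) {j k : ℕ} (hjk : j ≤ k) {x y : Fin n → ℝ}
    (h : dIdx Q k x = dIdx Q k y) : dIdx Q j x = dIdx Q j y := by
  have key : ∀ z : Fin n → ℝ, ∀ i, dIdx Q j z i = dIdx Q k z i / ((2 ^ (k - j) : ℕ) : ℤ) := by
    intro z i
    simp only [dIdx]
    rw [← Int.floor_div_natCast]
    congr 1
    have : (2:ℝ) ^ k = 2 ^ j * 2 ^ (k - j) := by rw [← pow_add]; congr 1; omega
    rw [this]; push_cast; field_simp
  ext i
  rw [key, key, h]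

theorem hoSet_iff {n : ℕ} (Q : RCube n) (x : Fin n → ℝ) : x ∈ hoSet Q ↔ dIdx Q 0 x = 0 := by
  rw [← mem_dyad]
  have : dyad Q 0 0 = Q := by
    cases Q; simp [dyad]; ext i; ring
  rw [this]

theorem volume_dyad_succ {n : ℕ} (Q : RCube n) (k : ℕ) (v w : Fin n → ℤ) :
    volume (dyad Q k v).toSet = ENNReal.ofReal (2 ^ n) * volume (dyad Q (k + 1) w).toSet := by
  rw [volume_toSet, volume_toSet, ← ENNReal.ofReal_mul (by positivity)]
  congr 1
  simp only [dyad]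
  rw [← mul_pow]; congr 1; rw [pow_succ]; field_simp

theorem calderon {n : ℕ} (Q : RCube n) (F : Set (Fin n → ℝ)) (hFm : MeasurableSet F)
    (hFs : F ⊆ hoSet Q) {α : ℝ} (hα0 : 0 < α) (hα1 : α < 1)
    (hv : volume F ≤ ENNReal.ofReal α * volume Q.toSet) :
    ∃ (J : Set (ℕ × (Fin n → ℤ))) (P : J → RCube n),
      Pairwise (Function.onFun Disjoint fun j => hoSet (P j)) ∧
      (∀ j, hoSet (P j) ⊆ hoSet Q) ∧
      (∀ j, volume (F ∩ hoSet (P j)) ≤ ENNReal.ofReal (2 ^ n * α) * volume (P j).toSet) ∧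
      (∀ j, ENNReal.ofReal α * volume (P j).toSet ≤ volume (F ∩ hoSet (P j))) ∧
      volume (F \ ⋃ j, hoSet (P j)) = 0 := by
  -- density condition
  let D : ℕ → (Fin n → ℤ) → Prop := fun k v =>
    ENNReal.ofReal α * volume (dyad Q k v).toSet < volume (F ∩ hoSet (dyad Q k v))
  let J : Set (ℕ × (Fin n → ℤ)) := {a | D a.1 a.2 ∧
    ∀ x ∈ hoSet (dyad Q a.1 a.2), ∀ j < a.1, ¬ D j (dIdx Q j x)}
  have hne : ∀ a ∈ J, ∃ x ∈ F, x ∈ hoSet (dyad Q a.1 a.2) := by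
    intro a ha
    have : volume (F ∩ hoSet (dyad Q a.1 a.2)) ≠ 0 := (lt_of_le_of_lt (zero_le) ha.1).ne'
    obtain ⟨x, hx⟩ := nonempty_of_measure_ne_zero this
    exact ⟨x, hx.1, hx.2⟩
  refine ⟨J, fun a => dyad Q a.1.1 a.1.2, ?_, ?_, ?_, fun a => a.2.1.le, ?_⟩
  · intro a b hab
    rw [Function.onFun, Set.disjoint_left]
    intro x hxa hxb
    have ea := (mem_dyad _ _ _ _).1 hxa
    have eb := (mem_dyad _ _ _ _).1 hxb
    apply hab
    rcases lt_trichotomy a.1.1 b.1.1 with h | h | h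
    · exact absurd (ea ▸ a.2.1) (b.2.2 x hxb _ h)
    · apply Subtype.ext
      refine Prod.ext h ?_
      rw [← ea, ← eb, h]
    · exact absurd (eb ▸ b.2.1) (a.2.2 x hxa _ h)
  · intro a y hy
    obtain ⟨x, hxF, hx⟩ := hne a.1 a.2
    rw [hoSet_iff, ← (hoSet_iff Q x).1 (hFs hxF)]
    refine dIdx_anc Q (Nat.zero_le a.1.1) ?_
    rw [(mem_dyad _ _ _ _).1 hx, (mem_dyad _ _ _ _).1 hy]
  · rintro ⟨⟨k, v⟩, ha⟩
    obtain ⟨x, hxF, hx⟩ := hne _ ha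
    simp only at hx ⊢
    cases k with
    | zero =>
      exfalso
      have h1 : dIdx Q 0 x = v := (mem_dyad _ _ _ _).1 hx
      have h2 := (hoSet_iff Q x).1 (hFs hxF)
      have h3 := ha.1
      simp only [D] at h3
      have h4 : volume (dyad Q 0 v).toSet = volume Q.toSet := by
        rw [volume_toSet, volume_toSet]; simp [dyad]
      rw [h4] at h3
      exact absurd (h3.trans_le (measure_mono inter_subset_left)) (not_lt.2 hv)
    | succ k =>
      have h1 := ha.2 x hx k (Nat.lt_succ_self k)
      simp only [D, not_lt] at h1
      rw [volume_dyad_succ Q k _ v, ← mul_assoc, ← ENNReal.ofReal_mul hα0.le] at h1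
      rw [mul_comm (2 ^ n)]
      refine le_trans (measure_mono (inter_subset_inter_right _ ?_)) h1
      intro y hy
      rw [mem_dyad] at hx hy ⊢
      exact dIdx_anc Q (Nat.le_succ k) (hy.trans hx.symm)
  · have hae := IsUnifLocDoublingMeasure.ae_tendsto_measure_inter_div
      (volume : Measure (Fin n → ℝ)) F 1
    rw [ae_restrict_iff' hFm] at hae
    refine measure_mono_null ?_ hae
    rintro x ⟨hxF, hxU⟩
    simp only [mem_compl_iff, mem_ofPred_eq]
    intro hx
    have hx := hx hxF (fun k : ℕ => (dyad Q k (dIdx Q k x)).center)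
      (fun k : ℕ => (dyad Q k (dIdx Q k x)).side / 2) (l := Filter.atTop) ?_ ?_
    · apply hxU
      simp_rw [← toSet_eq] at hx
      have hlt : ENNReal.ofReal α < 1 := by simpa using hα1
      have hex : ∃ k, D k (dIdx Q k x) := by
        obtain ⟨k, hk⟩ := (hx.eventually (lt_mem_nhds hlt)).exists
        refine ⟨k, ?_⟩
        simp only [D]
        rw [ENNReal.lt_div_iff_mul_lt (Or.inl (volume_toSet_ne_zero _))
          (Or.inl (volume_toSet_ne_top _))] at hk
        refine hk.trans_eq (measure_congr ?_)
        exact (ae_eq_refl _).inter (hoSet_ae _).symm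
      classical
      have hk := Nat.find_spec hex
      refine mem_iUnion.2 ⟨⟨(Nat.find hex, dIdx Q (Nat.find hex) x), hk, ?_⟩, ?_⟩
      · intro y hy j hj
        simp only at hy hj
        rw [mem_dyad] at hy
        rw [dIdx_anc Q hj.le hy]
        exact Nat.find_min hex hj
      · rw [mem_dyad]
    · have hs := Q.side_pos
      rw [tendsto_nhdsWithin_iff]
      refine ⟨?_, Filter.Eventually.of_forall fun k => ?_⟩
      · simp only [dyad]
        have : Filter.Tendsto (fun k : ℕ => Q.side / 2 * (1 / 2 : ℝ) ^ k) Filter.atTop (nhds (Q.side / 2 * 0)) :=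
          (_root_.tendsto_pow_atTop_nhds_zero_of_lt_one (by norm_num) (by norm_num)).const_mul _
        rw [mul_zero] at this
        refine this.congr fun k => ?_
        rw [one_div, inv_pow]; ring
      · simp only [dyad, mem_Ioi]; positivity
    · refine Filter.Eventually.of_forall fun k => ?_
      rw [one_mul, ← toSet_eq]
      exact hoSet_subset _ ((mem_dyad _ _ _ _).2 rfl)

theorem decay {n : ℕ} {p : (Fin n → ℝ) → ℝ} (hpm : Measurable p)
    (hp1 : ∀ x, 1 ≤ p x)
    {B : ℝ} (hB1 : 1 ≤ B) (hB : ∀ᵐ x ∂(volume : Measure (Fin n → ℝ)), p x ≤ B)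
    (hA : AInfty p) :
    ∃ c ∈ Ioo (0:ℝ) 1, ∃ γ ∈ Ioo (0:ℝ) 1, ∀ (k : ℕ) (ι : Type) [Countable ι] (Q : ι → RCube n) (t : ι → ℝ)
      (F : ι → Set (Fin n → ℝ)), Pairwise (Function.onFun Disjoint fun i => hoSet (Q i)) →
      (∀ i, 0 ≤ t i) → (∀ i, MeasurableSet (F i)) → (∀ i, F i ⊆ hoSet (Q i)) →
      (∀ i, volume (F i) ≤ ENNReal.ofReal (c ^ k) * volume (Q i).toSet) →
      ∑' i, modI p (hoSet (Q i)) (t i) ≤ 1 → ∑' i, modI p (F i) (t i / γ ^ k) ≤ 1 := by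
  obtain ⟨κ, ⟨hκ0, hκ1⟩, γ, ⟨hγ0, hγ1⟩, h⟩ := stepH hpm hp1 hB1 hB hA
  have h2n : (1:ℝ) ≤ 2 ^ n := one_le_pow₀ (by norm_num)
  set c := κ / 2 ^ n with hc
  have hc0 : 0 < c := by positivity
  have hc1 : c < 1 := by rw [hc, div_lt_one (by positivity)]; linarith
  have hcκ : 2 ^ n * c = κ := by rw [hc]; field_simp
  refine ⟨c, ⟨hc0, hc1⟩, γ, ⟨hγ0, hγ1⟩, ?_⟩
  intro k
  induction k with
  | zero =>
    intro ι _ Q t F hd ht hFm hFs hFv hsum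
    refine le_trans (ENNReal.tsum_le_tsum fun i => ?_) hsum
    simp only [pow_zero, div_one]
    exact modI_mono p (hFs i) _
  | succ k ih =>
    intro ι _ Q t F hd ht hFm hFs hFv hsum
    have hFv' : ∀ i, volume (F i) ≤ ENNReal.ofReal c * volume (Q i).toSet := by
      intro i
      refine (hFv i).trans ?_
      gcongr
      rw [pow_succ]
      exact mul_le_of_le_one_left hc0.le (pow_le_one₀ hc0.le hc1.le)
    choose J P hPd hPs hPu hPl hPc using fun i => calderon (Q i) (F i) (hFm i) (hFs i) hc0 hc1 (hFv' i)
    have hU : ∀ i, ∑' j, modI p (hoSet (P i j)) (t i / γ ^ k) =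
        modI p (⋃ j, hoSet (P i j)) (t i / γ ^ k) := fun i =>
      (lintegral_iUnion (fun j => hoSet_meas _) (hPd i) _).symm
    have hih := ih ι Q t (fun i => ⋃ j, hoSet (P i j)) hd ht
      (fun i => MeasurableSet.iUnion fun j => hoSet_meas _) (fun i => iUnion_subset (hPs i)) (by
        intro i
        have hc0' : ENNReal.ofReal c ≠ 0 := by simpa using hc0
        refine (ENNReal.mul_le_mul_iff_right hc0' ENNReal.ofReal_ne_top).1 ?_
        calc ENNReal.ofReal c * volume (⋃ j, hoSet (P i j))
            = ∑' j, ENNReal.ofReal c * volume (P i j).toSet := by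
              rw [measure_iUnion (hPd i) (fun j => hoSet_meas _), ENNReal.tsum_mul_left]
              simp_rw [volume_hoSet]
          _ ≤ ∑' j, volume (F i ∩ hoSet (P i j)) := ENNReal.tsum_le_tsum (hPl i)
          _ = volume (⋃ j, F i ∩ hoSet (P i j)) := by
              rw [measure_iUnion _ (fun j => (hFm i).inter (hoSet_meas _))]
              intro a b hab
              exact (hPd i hab).mono inter_subset_right inter_subset_right
          _ ≤ volume (F i) := measure_mono (iUnion_subset fun j => inter_subset_left)
          _ ≤ _ := hFv i
          _ = _ := by
            rw [← mul_assoc, ← ENNReal.ofReal_mul hc0.le]; congr 2; ring) hsum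
    have hfin := h (Σ i, J i) (fun a => P a.1 a.2) (fun a => t a.1 / γ ^ k)
      (fun a => F a.1 ∩ hoSet (P a.1 a.2)) (by
        rintro ⟨i, a⟩ ⟨j, b⟩ hab
        by_cases hij : i = j
        · subst hij
          have : a ≠ b := fun h => hab (by rw [h])
          exact hPd i this
        · exact (hd hij).mono (hPs i a) (hPs j b)) (fun a => div_nonneg (ht _) (by positivity))
      (fun a => (hFm _).inter (hoSet_meas _)) (fun a => inter_subset_right)
      (fun a => by rw [← hcκ]; exact hPu _ _) (by
        rw [ENNReal.tsum_sigma']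
        simp_rw [hU]
        exact hih)
    rw [ENNReal.tsum_sigma'] at hfin
    refine le_trans (ENNReal.tsum_le_tsum fun i => ?_) hfin
    simp only
    rw [div_div, ← pow_succ]
    unfold modI
    rw [← lintegral_iUnion (fun j => (hFm i).inter (hoSet_meas _)) (fun a b hab =>
      (hPd i hab).mono inter_subset_right inter_subset_right), ← inter_iUnion]
    refine lintegral_mono' (Measure.restrict_mono_ae ?_) le_rfl
    rw [ae_le_set]
    simpa [sdiff_self_inter] using hPc i


/-- normalized Lebesgue measure on a cube -/
def avgM {n : ℕ} (Q : RCube n) : Measure (Fin n → ℝ) :=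
  (volume Q.toSet)⁻¹ • volume.restrict Q.toSet

instance avgM_prob {n : ℕ} (Q : RCube n) : IsProbabilityMeasure (avgM Q) := by
  constructor
  simp [avgM, ENNReal.inv_mul_cancel (volume_toSet_ne_zero Q) (volume_toSet_ne_top Q)]

/-- failure of the reverse Hölder inequality with constant `K` -/
def rBad {n : ℕ} (p : (Fin n → ℝ) → ℝ) (r K : ℝ) (Q : RCube n) (t : ℝ) : Prop :=
  ENNReal.ofReal K * (∫⁻ x, ENNReal.ofReal t ^ p x ∂avgM Q) ^ r ≤
    ∫⁻ x, (ENNReal.ofReal t ^ p x) ^ r ∂avgM Q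

theorem avgM_lint {n : ℕ} (Q : RCube n) (f : (Fin n → ℝ) → ℝ≥0∞) :
    ∫⁻ x, f x ∂avgM Q = (volume Q.toSet)⁻¹ * ∫⁻ x in Q.toSet, f x := by
  rw [avgM, lintegral_smul_measure, smul_eq_mul]

theorem vol_avgM {n : ℕ} (Q : RCube n) (f : (Fin n → ℝ) → ℝ≥0∞) :
    volume Q.toSet * ∫⁻ x, f x ∂avgM Q = ∫⁻ x in Q.toSet, f x := by
  rw [avgM_lint, ← mul_assoc, ENNReal.mul_inv_cancel (volume_toSet_ne_zero Q)
    (volume_toSet_ne_top Q), one_mul]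

theorem modI_pos {n : ℕ} {p : (Fin n → ℝ) → ℝ} (hpm : Measurable p) (Q : RCube n)
    {t : ℝ} (ht : 0 < t) : modI p Q.toSet t ≠ 0 := by
  intro h
  unfold modI at h
  rw [lintegral_eq_zero_iff (rpow_meas hpm _)] at h
  have : ∀ᵐ x ∂(volume.restrict Q.toSet), False := by
    filter_upwards [h] with x hx
    simp only [Pi.zero_apply, ENNReal.rpow_eq_zero_iff] at hx
    rcases hx with h | h
    · exact absurd h.1 (by simpa using ht)
    · exact absurd h.1 ENNReal.ofReal_ne_top
  have h2 := ae_iff.1 this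
  simp at h2
  exact volume_toSet_ne_zero Q h2

theorem level_bound {c g e : ℝ} (hc0 : 0 < c) (hc1 : c < 1) (hg0 : 0 < g) (he : 0 < e)
    (hce : c ^ e = g) {u a : ℝ≥0∞} (hu : u ≠ ∞) (ha0 : a ≠ 0) :
    u ^ (1 + e) ≤ a ^ e * (u + ∑' k : ℕ, ENNReal.ofReal (g⁻¹ ^ (k + 1)) *
      (if a < ENNReal.ofReal (c ^ k) * u then u else 0)) := by
  have hur : u ^ (1 + e) = u ^ e * u := by
    rw [add_comm, ENNReal.rpow_add_of_nonneg _ _ he.le zero_le_one, ENNReal.rpow_one]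
  rw [hur]
  by_cases hua : u ≤ a
  · refine mul_le_mul' (ENNReal.rpow_le_rpow hua he.le) le_self_add
  push Not at hua
  have hex : ∃ j : ℕ, ENNReal.ofReal (c ^ j) * u ≤ a := by
    have h1 : Filter.Tendsto (fun j : ℕ => ENNReal.ofReal (c ^ j) * u) Filter.atTop
        (nhds (ENNReal.ofReal 0 * u)) :=
      ENNReal.Tendsto.mul_const (ENNReal.tendsto_ofReal
        (_root_.tendsto_pow_atTop_nhds_zero_of_lt_one hc0.le hc1)) (Or.inr hu)
    have h2 : ENNReal.ofReal 0 * u < a := by simpa using pos_iff_ne_zero.2 ha0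
    obtain ⟨j, hj⟩ := (h1.eventually (gt_mem_nhds h2)).exists
    exact ⟨j, hj.le⟩
  classical
  have hj := Nat.find_spec hex
  have hj0 : Nat.find hex ≠ 0 := by
    intro h0
    rw [h0] at hj
    simp at hj
    exact absurd hua (not_lt.2 hj)
  obtain ⟨k, hk⟩ := Nat.exists_eq_succ_of_ne_zero hj0
  have hk' : a < ENNReal.ofReal (c ^ k) * u := by
    have := Nat.find_min hex (m := k) (by omega)
    push Not at this
    exact this
  rw [hk] at hj
  have hterm : u ^ e ≤ a ^ e * ENNReal.ofReal (g⁻¹ ^ (k + 1)) := by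
    have h3 : ENNReal.ofReal (g ^ (k + 1)) * u ^ e ≤ a ^ e := by
      refine le_trans (le_of_eq ?_) (ENNReal.rpow_le_rpow hj he.le)
      rw [ENNReal.mul_rpow_of_nonneg _ _ he.le, ENNReal.ofReal_rpow_of_pos (by positivity), ← hce]
      congr 2
      rw [← Real.rpow_natCast, ← Real.rpow_natCast, ← Real.rpow_mul hc0.le, ← Real.rpow_mul hc0.le, mul_comm]
    calc u ^ e = ENNReal.ofReal (g⁻¹ ^ (k + 1)) * (ENNReal.ofReal (g ^ (k + 1)) * u ^ e) := by
          rw [← mul_assoc, ← ENNReal.ofReal_mul (by positivity), ← mul_pow,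
            inv_mul_cancel₀ hg0.ne']; simp
      _ ≤ ENNReal.ofReal (g⁻¹ ^ (k + 1)) * a ^ e := by gcongr
      _ = _ := mul_comm _ _
  calc u ^ e * u ≤ a ^ e * ENNReal.ofReal (g⁻¹ ^ (k + 1)) * u := by gcongr
    _ = a ^ e * (ENNReal.ofReal (g⁻¹ ^ (k + 1)) * (if a < ENNReal.ofReal (c ^ k) * u then u else 0)) := by
        rw [if_pos hk', mul_assoc]
    _ ≤ _ := by
        gcongr
        refine le_trans ?_ le_add_self
        exact ENNReal.le_tsum (f := fun k : ℕ => ENNReal.ofReal (g⁻¹ ^ (k + 1)) *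
          (if a < ENNReal.ofReal (c ^ k) * u then u else 0)) k

theorem star {n : ℕ} {p : (Fin n → ℝ) → ℝ} (hpm : Measurable p)
    (hp1 : ∀ x, 1 ≤ p x)
    {B : ℝ} (hB1 : 1 ≤ B) (hB : ∀ᵐ x ∂(volume : Measure (Fin n → ℝ)), p x ≤ B)
    (hA : AInfty p) :
    ∃ r : ℝ, 1 < r ∧ ∃ K : ℝ, 1 ≤ K ∧ ∀ (ι : Type) [Countable ι] (Q : ι → RCube n) (t : ι → ℝ),
      Pairwise (Function.onFun Disjoint fun i => hoSet (Q i)) →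
      (∀ i, 0 < t i) → (∀ i, rBad p r K (Q i) (t i)) →
      ∑' i, modI p (Q i).toSet (t i) ≤ 1 → ∑' i, modI p (Q i).toSet (t i) ≤ 1 / 2 := by
  obtain ⟨c, ⟨hc0, hc1⟩, γ, ⟨hγ0, hγ1⟩, h⟩ := decay hpm hp1 hB1 hB hA
  set g := Real.sqrt γ with hg
  have hg0 : 0 < g := Real.sqrt_pos.2 hγ0
  have hg1 : g < 1 := by rw [hg, Real.sqrt_lt' one_pos]; linarith
  have hgg : g * g = γ := Real.mul_self_sqrt hγ0.le
  set e := Real.log g / Real.log c with he_def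
  have he : 0 < e := div_pos_of_neg_of_neg (Real.log_neg hg0 hg1) (Real.log_neg hc0 hc1)
  have hce : c ^ e = g := by
    rw [Real.rpow_def_of_pos hc0, he_def, mul_div_cancel₀ _ (Real.log_neg hc0 hc1).ne, Real.exp_log hg0]
  have h1g : 0 < 1 - g := by linarith
  set C := 1 + g⁻¹ * (1 - g)⁻¹ with hC
  have hC1 : 1 ≤ C := by rw [hC]; have : 0 < g⁻¹ * (1 - g)⁻¹ := by positivity
                         linarith
  refine ⟨1 + e, by linarith, 2 * C, by linarith, ?_⟩
  intro ι _ Q t hd ht hbad hsum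
  let a : ι → ℝ≥0∞ := fun i => ∫⁻ x, ENNReal.ofReal (t i) ^ p x ∂avgM (Q i)
  let F : ℕ → ι → Set (Fin n → ℝ) := fun k i =>
    hoSet (Q i) ∩ {x | a i < ENNReal.ofReal (c ^ k) * ENNReal.ofReal (t i) ^ p x}
  have hmeas : ∀ i, Measurable fun x => ENNReal.ofReal (t i) ^ p x := fun i => rpow_meas hpm _
  have hSm : ∀ k i, MeasurableSet {x | a i < ENNReal.ofReal (c ^ k) * ENNReal.ofReal (t i) ^ p x} :=
    fun k i => measurableSet_lt measurable_const ((hmeas i).const_mul _)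
  have hFm : ∀ k i, MeasurableSet (F k i) := fun k i => (hoSet_meas _).inter (hSm k i)
  have hG : ∀ i, modI p (Q i).toSet (t i) = volume (Q i).toSet * a i := fun i =>
    (vol_avgM (Q i) _).symm
  have hGt : ∀ i, modI p (Q i).toSet (t i) ≠ ∞ := fun i =>
    ne_top_of_le_ne_top one_ne_top ((ENNReal.le_tsum i).trans hsum)
  have ha0 : ∀ i, a i ≠ 0 := by
    intro i h0
    apply modI_pos hpm (Q i) (ht i)
    rw [hG, h0, mul_zero]
  have hat : ∀ i, a i ≠ ∞ := by
    intro i h0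
    apply hGt i
    rw [hG, h0, ENNReal.mul_top (volume_toSet_ne_zero _)]
  have hsum' : ∑' i, modI p (hoSet (Q i)) (t i) ≤ 1 := by
    refine le_trans (le_of_eq ?_) hsum
    exact tsum_congr fun i => modI_congr p (hoSet_ae _) _
  have hdec : ∀ k, ∑' i, modI p (F k i) (t i) ≤ ENNReal.ofReal (γ ^ k) := by
    intro k
    have h1 := h k ι Q t (F k) hd (fun i => (ht i).le) (hFm k) (fun i => inter_subset_left) (by
      intro i
      refine (ENNReal.mul_le_mul_iff_right (ha0 i) (hat i)).1 ?_
      calc a i * volume (F k i)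
          ≤ a i * (volume.restrict (Q i).toSet) {x | a i ≤ ENNReal.ofReal (c ^ k) * ENNReal.ofReal (t i) ^ p x} := by
            refine mul_le_mul_right ?_ (a i)
            rw [Measure.restrict_apply (measurableSet_le measurable_const ((hmeas i).const_mul _))]
            refine measure_mono ?_
            rintro x ⟨hx1, hx2⟩
            refine ⟨?_, hoSet_subset _ hx1⟩
            simp only [mem_ofPred_eq] at hx2 ⊢
            exact hx2.le
        _ ≤ ∫⁻ x in (Q i).toSet, ENNReal.ofReal (c ^ k) * ENNReal.ofReal (t i) ^ p x :=
            mul_meas_ge_le_lintegral₀ ((hmeas i).const_mul _).aemeasurable _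
        _ = ENNReal.ofReal (c ^ k) * modI p (Q i).toSet (t i) := lintegral_const_mul _ (hmeas i)
        _ = _ := by rw [hG]; ring) hsum'
    calc ∑' i, modI p (F k i) (t i) ≤ ∑' i, ENNReal.ofReal (γ ^ k) * modI p (F k i) (t i / γ ^ k) := by
          refine ENNReal.tsum_le_tsum fun i => ?_
          have := modI_upper hpm hp1 (F k i) (m := γ ^ k) (t := t i / γ ^ k) (by positivity)
            (pow_le_one₀ hγ0.le hγ1.le)
          rwa [mul_div_cancel₀ _ (by positivity)] at this
      _ = ENNReal.ofReal (γ ^ k) * ∑' i, modI p (F k i) (t i / γ ^ k) := ENNReal.tsum_mul_left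
      _ ≤ ENNReal.ofReal (γ ^ k) * 1 := by gcongr
      _ = _ := mul_one _
  have hcube : ∀ i, ENNReal.ofReal (2 * C) * modI p (Q i).toSet (t i) ≤
      modI p (Q i).toSet (t i) + ∑' k : ℕ, ENNReal.ofReal (g⁻¹ ^ (k + 1)) * modI p (F k i) (t i) := by
    intro i
    have hae0 : a i ^ e ≠ 0 := by
      simp [ENNReal.rpow_eq_zero_iff, ha0 i, hat i]
    have haet : a i ^ e ≠ ∞ := ENNReal.rpow_ne_top_of_nonneg he.le (hat i)
    refine (ENNReal.mul_le_mul_iff_right hae0 haet).1 ?_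
    have hb := hbad i
    unfold rBad at hb
    calc a i ^ e * (ENNReal.ofReal (2 * C) * modI p (Q i).toSet (t i))
        = volume (Q i).toSet * (ENNReal.ofReal (2 * C) * a i ^ (1 + e)) := by
          rw [hG, ENNReal.rpow_add_of_nonneg _ _ zero_le_one he.le, ENNReal.rpow_one]; ring
      _ ≤ volume (Q i).toSet * ∫⁻ x, (ENNReal.ofReal (t i) ^ p x) ^ (1 + e) ∂avgM (Q i) := by
          gcongr
      _ = ∫⁻ x in (Q i).toSet, (ENNReal.ofReal (t i) ^ p x) ^ (1 + e) := vol_avgM _ _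
      _ = ∫⁻ x in hoSet (Q i), (ENNReal.ofReal (t i) ^ p x) ^ (1 + e) := by
          rw [Measure.restrict_congr_set (hoSet_ae _)]
      _ ≤ ∫⁻ x in hoSet (Q i), a i ^ e * (ENNReal.ofReal (t i) ^ p x + ∑' k : ℕ, ENNReal.ofReal (g⁻¹ ^ (k + 1)) *
            (if a i < ENNReal.ofReal (c ^ k) * ENNReal.ofReal (t i) ^ p x then ENNReal.ofReal (t i) ^ p x else 0)) := by
          refine lintegral_mono fun x => ?_
          exact level_bound hc0 hc1 hg0 he hce
            (ENNReal.rpow_ne_top_of_nonneg (by linarith [hp1 x]) ENNReal.ofReal_ne_top) (ha0 i)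
      _ = a i ^ e * (modI p (hoSet (Q i)) (t i) + ∑' k : ℕ, ENNReal.ofReal (g⁻¹ ^ (k + 1)) * modI p (F k i) (t i)) := by
          have hind : ∀ k, Measurable fun x => (if a i < ENNReal.ofReal (c ^ k) * ENNReal.ofReal (t i) ^ p x
              then ENNReal.ofReal (t i) ^ p x else 0) := fun k =>
            Measurable.ite (hSm k i) (hmeas i) measurable_const
          rw [lintegral_const_mul' _ _ haet, lintegral_add_left (hmeas i),
            lintegral_tsum (fun k => ((hind k).const_mul _).aemeasurable)]
          congr 3
          ext k
          rw [lintegral_const_mul _ (hind k)]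
          congr 1
          unfold modI
          simp only [F]
          rw [inter_comm, ← Measure.restrict_restrict (hSm k i), ← lintegral_indicator (hSm k i)]
          refine lintegral_congr fun x => ?_
          simp [indicator_apply]
      _ = _ := by rw [modI_congr p (hoSet_ae _)]
  have htot : ENNReal.ofReal (2 * C) * ∑' i, modI p (Q i).toSet (t i) ≤ ENNReal.ofReal C := by
    calc _ = ∑' i, ENNReal.ofReal (2 * C) * modI p (Q i).toSet (t i) := ENNReal.tsum_mul_left.symm
      _ ≤ ∑' i, (modI p (Q i).toSet (t i) + ∑' k : ℕ, ENNReal.ofReal (g⁻¹ ^ (k + 1)) * modI p (F k i) (t i)) :=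
          ENNReal.tsum_le_tsum hcube
      _ = ∑' i, modI p (Q i).toSet (t i) + ∑' k : ℕ, ENNReal.ofReal (g⁻¹ ^ (k + 1)) * ∑' i, modI p (F k i) (t i) := by
          rw [ENNReal.tsum_add, ENNReal.tsum_comm]
          simp_rw [ENNReal.tsum_mul_left]
      _ ≤ 1 + ∑' k : ℕ, ENNReal.ofReal (g⁻¹ ^ (k + 1)) * ENNReal.ofReal (γ ^ k) := by
          gcongr with k
          exact hdec k
      _ = 1 + ∑' k : ℕ, ENNReal.ofReal (g⁻¹ * g ^ k) := by
          congr 2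
          ext k
          rw [← ENNReal.ofReal_mul (by positivity), ← hgg]
          congr 1
          rw [mul_pow, pow_succ, inv_pow]
          field_simp
      _ = 1 + ENNReal.ofReal (g⁻¹ * (1 - g)⁻¹) := by
          rw [← ENNReal.ofReal_tsum_of_nonneg (fun k => by positivity)
            ((summable_geometric_of_lt_one hg0.le hg1).mul_left _), tsum_mul_left,
            tsum_geometric_of_lt_one hg0.le hg1]
      _ = _ := by rw [hC, ENNReal.ofReal_add zero_le_one (by positivity)]; simp
  have h0 : ENNReal.ofReal (2 * C) ≠ 0 := by simp; linarith
  refine (ENNReal.mul_le_mul_iff_right h0 ENNReal.ofReal_ne_top).1 (htot.trans (le_of_eq ?_))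
  have h2 : (1:ℝ≥0∞) / 2 = ENNReal.ofReal (1/2) := by
    rw [ENNReal.ofReal_div_of_pos (by norm_num)]; simp
  rw [h2, ← ENNReal.ofReal_mul (by positivity)]
  congr 1; ring


theorem jens {α : Type*} [MeasurableSpace α] (μ : Measure α) [IsProbabilityMeasure μ]
    {w : α → ℝ≥0∞} (hw : Measurable w) {β : ℝ} (h0 : 0 ≤ β) (h1 : β ≤ 1) :
    ∫⁻ x, w x ^ β ∂μ ≤ (∫⁻ x, w x ∂μ) ^ β := by
  rcases h0.eq_or_lt with rfl | h0
  · simp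
  have := eLpNorm'_le_eLpNorm'_of_exponent_le h0 h1 μ hw.aestronglyMeasurable
  simp only [eLpNorm', enorm_eq_self, ENNReal.rpow_one, div_one] at this
  calc _ = ((∫⁻ x, w x ^ β ∂μ) ^ (1 / β)) ^ β := by
        rw [← ENNReal.rpow_mul, one_div_mul_cancel h0.ne', ENNReal.rpow_one]
    _ ≤ _ := ENNReal.rpow_le_rpow this h0.le

theorem holderF {α : Type*} [MeasurableSpace α] (μ : Measure α)
    {w : α → ℝ≥0∞} (hw : Measurable w) {q : ℝ} (hq : 1 < q) (F : Set α) {τ : ℝ} (hτ : 0 ≤ τ)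
    (hF : μ F ≤ ENNReal.ofReal τ) :
    ∫⁻ x in F, w x ∂μ ≤ (∫⁻ x, w x ^ q ∂μ) ^ (1 / q) * ENNReal.ofReal (τ ^ (1 - 1 / q)) := by
  have hc := Real.HolderConjugate.conjExponent hq
  have := ENNReal.lintegral_mul_le_Lp_mul_Lq (μ.restrict F) hc (f := w) (g := fun _ => 1)
    hw.aemeasurable aemeasurable_const
  simp only [Pi.mul_apply, mul_one, ENNReal.one_rpow, lintegral_const, one_mul,
    Measure.restrict_apply_univ] at this
  have he : 1 / q.conjExponent = 1 - 1 / q := by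
    have := hc.inv_add_inv_eq_one
    simp only [one_div]; linarith
  have he0 : 0 ≤ 1 - 1 / q := by
    rw [sub_nonneg, div_le_one (by linarith)]; exact hq.le
  refine this.trans ?_
  rw [he, ← ENNReal.ofReal_rpow_of_nonneg hτ he0]
  gcongr
  exact Measure.restrict_le_self

theorem lemJ1 {α : Type*} [MeasurableSpace α] (μ : Measure α) [IsProbabilityMeasure μ]
    {w : α → ℝ≥0∞} (hw : Measurable w) {r β₀ β K τ : ℝ} (hβ0 : 0 < β₀) (hr : 1 < r * β₀)
    (hβ : β₀ ≤ β) (hβ1 : β ≤ 1) (hK : 1 ≤ K) (hτ0 : 0 < τ) (hτ1 : τ ≤ 1)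
    (hτ : K * 2 ^ r * τ ^ (r * β₀ - 1) ≤ 1) (F : Set α) (hF : μ F ≤ ENNReal.ofReal τ)
    (hbad : ∫⁻ x, w x ∂μ ≤ 2 * ∫⁻ x in F, w x ∂μ) :
    ENNReal.ofReal K * (∫⁻ x, w x ^ β ∂μ) ^ r ≤ ∫⁻ x, w x ^ (r * β) ∂μ := by
  have hr0 : 0 < r := by
    by_contra! h
    nlinarith
  have hq : 1 < r * β := lt_of_lt_of_le hr (by gcongr)
  have hq0 : 0 < r * β := by linarith
  have hqr : r * β ≤ r := by nlinarith
  have h1 := holderF μ hw hq F hτ0.le hF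
  have h2 : (∫⁻ x, w x ∂μ) ^ (r * β) ≤
      ENNReal.ofReal (2 ^ (r * β) * τ ^ (r * β - 1)) * ∫⁻ x, w x ^ (r * β) ∂μ := by
    calc (∫⁻ x, w x ∂μ) ^ (r * β) ≤ (2 * ((∫⁻ x, w x ^ (r * β) ∂μ) ^ (1 / (r * β)) *
          ENNReal.ofReal (τ ^ (1 - 1 / (r * β))))) ^ (r * β) := by
          refine ENNReal.rpow_le_rpow (hbad.trans ?_) hq0.le
          gcongr
      _ = _ := by
          rw [ENNReal.mul_rpow_of_nonneg _ _ hq0.le, ENNReal.mul_rpow_of_nonneg _ _ hq0.le,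
            ← ENNReal.rpow_mul, one_div_mul_cancel hq0.ne', ENNReal.rpow_one,
            ENNReal.ofReal_rpow_of_pos (by positivity), ← Real.rpow_mul hτ0.le,
            ENNReal.ofReal_mul (by positivity)]
          have e1 : (1 - 1 / (r * β)) * (r * β) = r * β - 1 := by
            rw [sub_mul, one_div_mul_cancel hq0.ne']; ring
          have e2 : ENNReal.ofReal (2 ^ (r * β)) = 2 ^ (r * β) := by
            rw [← ENNReal.ofReal_rpow_of_pos (by norm_num)]; simp
          rw [e1, e2]; ring
  have h3 : (∫⁻ x, w x ^ β ∂μ) ^ r ≤ (∫⁻ x, w x ∂μ) ^ (r * β) := by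
    rw [mul_comm, ENNReal.rpow_mul]
    exact ENNReal.rpow_le_rpow (jens μ hw (by linarith) hβ1) hr0.le
  calc _ ≤ ENNReal.ofReal K * (ENNReal.ofReal (2 ^ (r * β) * τ ^ (r * β - 1)) *
        ∫⁻ x, w x ^ (r * β) ∂μ) := by
        gcongr; exact h3.trans h2
    _ = ENNReal.ofReal (K * (2 ^ (r * β) * τ ^ (r * β - 1))) * ∫⁻ x, w x ^ (r * β) ∂μ := by
        rw [← mul_assoc, ← ENNReal.ofReal_mul (by linarith)]
    _ ≤ 1 * ∫⁻ x, w x ^ (r * β) ∂μ := by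
        gcongr
        rw [ENNReal.ofReal_le_one]
        refine le_trans ?_ hτ
        rw [← mul_assoc]
        have a1 : (2:ℝ) ^ (r * β) ≤ 2 ^ r := Real.rpow_le_rpow_of_exponent_le (by norm_num) hqr
        have a2 : τ ^ (r * β - 1) ≤ τ ^ (r * β₀ - 1) :=
          Real.rpow_le_rpow_of_exponent_ge hτ0 hτ1 (by nlinarith)
        gcongr
    _ = _ := one_mul _

theorem lemJ2n {α : Type*} [MeasurableSpace α] (μ : Measure α) [IsProbabilityMeasure μ]
    {w : α → ℝ≥0∞} (hw : Measurable w) (hwt : ∀ x, w x ≠ ∞) {r θ K τ M : ℝ} (hr : 1 < r)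
    (hθ0 : 0 ≤ θ) (hθ1 : θ ≤ 1) (hK : 1 ≤ K) (hτ0 : 0 < τ)
    (hM : 1 ≤ M) (hMK : K * M ^ (1 - r) ≤ 1 / 2)
    (hτ : 4 * M * K * τ ^ (1 - 1 / r) < 1) (F : Set α) (hF : μ F ≤ ENNReal.ofReal τ)
    (hA : ∫⁻ x, w x ∂μ = 1) (hAr : ∫⁻ x, w x ^ r ∂μ ≤ ENNReal.ofReal K) :
    ¬ (∫⁻ x, w x ^ θ ∂μ ≤ 2 * ∫⁻ x in F, w x ^ θ ∂μ) := by
  intro hbad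
  have hM0 : 0 < M := by linarith
  have hr0 : 0 < r := by linarith
  have hpt : ∀ x, w x ≤ ENNReal.ofReal M * w x ^ θ + ENNReal.ofReal (M ^ (1 - r)) * w x ^ r := by
    intro x
    by_cases hx : w x ≤ ENNReal.ofReal M
    · refine le_trans ?_ le_self_add
      calc w x = w x ^ (1 - θ) * w x ^ θ := by
            rw [← ENNReal.rpow_add_of_nonneg _ _ (by linarith) hθ0]; simp
        _ ≤ ENNReal.ofReal M ^ (1 - θ) * w x ^ θ := by
            gcongr
        _ ≤ ENNReal.ofReal M ^ (1:ℝ) * w x ^ θ := by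
            gcongr
            · simpa using hM
            · linarith
        _ = _ := by simp
    · push Not at hx
      refine le_trans ?_ le_add_self
      have hx0 : w x ≠ 0 := (lt_of_le_of_lt zero_le hx).ne'
      calc w x = ENNReal.ofReal (M ^ (1 - r)) * (w x * ENNReal.ofReal M ^ (r - 1)) := by
            rw [ENNReal.ofReal_rpow_of_pos hM0, mul_comm (w x), ← mul_assoc,
              ← ENNReal.ofReal_mul (by positivity), ← Real.rpow_add hM0]; simp
        _ ≤ ENNReal.ofReal (M ^ (1 - r)) * (w x * w x ^ (r - 1)) := by
            gcongr
        _ = _ := by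
            congr 1
            conv_lhs => enter [1]; rw [← ENNReal.rpow_one (w x)]
            rw [← ENNReal.rpow_add _ _ hx0 (hwt x)]; congr 1; ring
  have h1 : 1 ≤ ENNReal.ofReal M * (∫⁻ x, w x ^ θ ∂μ) + ENNReal.ofReal (1/2) := by
    calc 1 = ∫⁻ x, w x ∂μ := hA.symm
      _ ≤ ∫⁻ x, (ENNReal.ofReal M * w x ^ θ + ENNReal.ofReal (M ^ (1 - r)) * w x ^ r) ∂μ :=
          lintegral_mono hpt
      _ = ENNReal.ofReal M * (∫⁻ x, w x ^ θ ∂μ) + ENNReal.ofReal (M ^ (1 - r)) * ∫⁻ x, w x ^ r ∂μ := by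
          rw [lintegral_add_left ((hw.pow_const _).const_mul _), lintegral_const_mul _ (hw.pow_const _),
            lintegral_const_mul _ (hw.pow_const _)]
      _ ≤ _ := by
          gcongr
          calc _ ≤ ENNReal.ofReal (M ^ (1 - r)) * ENNReal.ofReal K := by gcongr
            _ = ENNReal.ofReal (K * M ^ (1 - r)) := by
              rw [mul_comm, ENNReal.ofReal_mul (by linarith)]
            _ ≤ _ := ENNReal.ofReal_le_ofReal hMK
  have h2 : ∫⁻ x in F, w x ^ θ ∂μ ≤ ENNReal.ofReal (K * τ ^ (1 - 1 / r)) := by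
    refine (holderF μ (hw.pow_const θ) hr F hτ0.le hF).trans ?_
    rw [ENNReal.ofReal_mul (by linarith)]
    gcongr
    have : ∫⁻ x, (w x ^ θ) ^ r ∂μ ≤ ENNReal.ofReal K ^ θ := by
      calc _ = ∫⁻ x, (w x ^ r) ^ θ ∂μ := by
            refine lintegral_congr fun x => ?_
            rw [← ENNReal.rpow_mul, ← ENNReal.rpow_mul, mul_comm]
        _ ≤ _ := jens μ (hw.pow_const r) hθ0 hθ1
        _ ≤ _ := ENNReal.rpow_le_rpow hAr hθ0
    calc _ ≤ (ENNReal.ofReal K ^ θ) ^ (1 / r) := ENNReal.rpow_le_rpow this (by positivity)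
      _ = ENNReal.ofReal K ^ (θ * (1 / r)) := by rw [← ENNReal.rpow_mul]
      _ ≤ ENNReal.ofReal K ^ (1:ℝ) := by
          refine ENNReal.rpow_le_rpow_of_exponent_le (by simpa using hK) ?_
          have : 1 / r ≤ 1 := by rw [div_le_one hr0]; exact hr.le
          have : 0 ≤ 1 / r := by positivity
          nlinarith
      _ = _ := by simp
  have h3 : (1:ℝ≥0∞) ≤ ENNReal.ofReal (M * (2 * (K * τ ^ (1 - 1 / r))) + 1 / 2) := by
    refine h1.trans ?_
    rw [ENNReal.ofReal_add (by positivity) (by norm_num), ENNReal.ofReal_mul hM0.le]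
    gcongr
    refine hbad.trans ?_
    rw [ENNReal.ofReal_mul (by norm_num)]
    gcongr
    simp
  rw [ENNReal.one_le_ofReal] at h3
  nlinarith

theorem lemJ2 {α : Type*} [MeasurableSpace α] (μ : Measure α) [IsProbabilityMeasure μ]
    {w : α → ℝ≥0∞} (hw : Measurable w) (hwt : ∀ x, w x ≠ ∞) {r θ K τ M : ℝ} (hr : 1 < r)
    (hθ0 : 0 ≤ θ) (hθ1 : θ ≤ 1) (hK : 1 ≤ K) (hτ0 : 0 < τ)
    (hM : 1 ≤ M) (hMK : K * M ^ (1 - r) ≤ 1 / 2)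
    (hτ : 4 * M * K * τ ^ (1 - 1 / r) < 1) (F : Set α) (hF : μ F ≤ ENNReal.ofReal τ)
    (hA0 : ∫⁻ x, w x ∂μ ≠ 0) (hAt : ∫⁻ x, w x ∂μ ≠ ∞)
    (hAr : ∫⁻ x, w x ^ r ∂μ ≤ ENNReal.ofReal K * (∫⁻ x, w x ∂μ) ^ r) :
    ¬ (∫⁻ x, w x ^ θ ∂μ ≤ 2 * ∫⁻ x in F, w x ^ θ ∂μ) := by
  set A := ∫⁻ x, w x ∂μ with hA
  have hi0 : A⁻¹ ≠ 0 := ENNReal.inv_ne_zero.2 hAt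
  have hit : A⁻¹ ≠ ∞ := ENNReal.inv_ne_top.2 hA0
  have hpow : ∀ s : ℝ, 0 ≤ s → ∀ ν : Measure α, ∫⁻ x, (A⁻¹ * w x) ^ s ∂ν = A⁻¹ ^ s * ∫⁻ x, w x ^ s ∂ν := by
    intro s hs ν
    rw [← lintegral_const_mul _ (hw.pow_const _)]
    refine lintegral_congr fun x => ?_
    rw [ENNReal.mul_rpow_of_nonneg _ _ hs]
  have := lemJ2n μ (w := fun x => A⁻¹ * w x) (hw.const_mul _) (fun x => ENNReal.mul_ne_top hit (hwt x))
    hr hθ0 hθ1 hK hτ0 hM hMK hτ F hF (by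
      rw [lintegral_const_mul _ hw, ← hA, ENNReal.inv_mul_cancel hA0 hAt]) (by
      rw [hpow r (by linarith)]
      calc _ ≤ A⁻¹ ^ r * (ENNReal.ofReal K * A ^ r) := by gcongr
        _ = ENNReal.ofReal K * (A⁻¹ * A) ^ r := by
          rw [ENNReal.mul_rpow_of_nonneg _ _ (by linarith)]; ring
        _ = _ := by rw [ENNReal.inv_mul_cancel hA0 hAt]; simp)
  intro hbad
  apply this
  rw [hpow θ hθ0, hpow θ hθ0, mul_left_comm]
  gcongr


theorem modI_cont {n : ℕ} {p : (Fin n → ℝ) → ℝ} (hpm : Measurable p) (hp1 : ∀ x, 1 ≤ p x)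
    {B : ℝ} (hB : ∀ᵐ x ∂(volume : Measure (Fin n → ℝ)), p x ≤ B) (hB1 : 1 ≤ B)
    (Q : RCube n) : Continuous fun s => modI p Q.toSet s := by
  rw [continuous_iff_continuousAt]
  intro s0
  unfold modI
  refine tendsto_lintegral_filter_of_dominated_convergence
    (fun _ => ENNReal.ofReal (max s0 0 + 1) ^ B) ?_ ?_ ?_ ?_
  · exact Filter.Eventually.of_forall fun s => rpow_meas hpm _
  · have : ∀ᶠ s in nhds s0, s < max s0 0 + 1 := by
      apply eventually_lt_nhds
      have := le_max_left s0 0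
      linarith
    filter_upwards [this] with s hs
    filter_upwards [ae_restrict_of_ae hB] with x hx
    calc ENNReal.ofReal s ^ p x ≤ ENNReal.ofReal (max s0 0 + 1) ^ p x :=
          ENNReal.rpow_le_rpow (ENNReal.ofReal_le_ofReal hs.le) (by linarith [hp1 x])
      _ ≤ _ := by
          refine ENNReal.rpow_le_rpow_of_exponent_le ?_ hx
          rw [ENNReal.one_le_ofReal]
          have := le_max_right s0 0
          linarith
  · rw [lintegral_const, Measure.restrict_apply_univ]
    exact ENNReal.mul_ne_top (ENNReal.rpow_ne_top_of_nonneg (by linarith) ofReal_ne_top)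
      (volume_toSet_ne_top Q)
  · refine Filter.Eventually.of_forall fun x => ?_
    exact ((ENNReal.continuous_rpow_const (y := p x)).comp ENNReal.continuous_ofReal).tendsto s0

theorem modI_monot {n : ℕ} {p : (Fin n → ℝ) → ℝ} (hp1 : ∀ x, 1 ≤ p x)
    (S : Set (Fin n → ℝ)) {s t : ℝ} (h : s ≤ t) : modI p S s ≤ modI p S t :=
  lintegral_mono fun x => ENNReal.rpow_le_rpow (ENNReal.ofReal_le_ofReal h) (by linarith [hp1 x])

theorem modI_le_one {n : ℕ} {p : (Fin n → ℝ) → ℝ} (hpm : Measurable p) (hp1 : ∀ x, 1 ≤ p x)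
    {B : ℝ} (hB : ∀ᵐ x ∂(volume : Measure (Fin n → ℝ)), p x ≤ B) (hB1 : 1 ≤ B)
    (Q : RCube n) {t : ℝ} (ht : 0 < t)
    (h : ENNReal.ofReal t ≤ (vnorm p (chiE Q.toSet))⁻¹) : modI p Q.toSet t ≤ 1 := by
  have key : ∀ s ∈ Ioo 0 t, modI p Q.toSet s ≤ 1 := by
    intro s hs
    have hlt : vnorm p (chiE Q.toSet) < (ENNReal.ofReal s)⁻¹ := by
      have : ENNReal.ofReal s < (vnorm p (chiE Q.toSet))⁻¹ :=
        lt_of_lt_of_le ((ENNReal.ofReal_lt_ofReal_iff ht).2 hs.2) h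
      exact ENNReal.lt_inv_iff_lt_inv.1 this
    obtain ⟨lam, ⟨h0, h1⟩, h2⟩ := sInf_lt_iff.1 hlt
    refine le_trans ?_ h1
    unfold modI
    rw [← lintegral_indicator (toSet_meas Q)]
    refine lintegral_mono fun x => ?_
    by_cases hx : x ∈ Q.toSet
    · simp only [indicator_of_mem hx, chiE]
      refine ENNReal.rpow_le_rpow ?_ (by linarith [hp1 x])
      rw [one_div]
      exact (ENNReal.lt_inv_iff_lt_inv.1 h2).le
    · simp [indicator_of_notMem hx]
  have hc := (modI_cont hpm hp1 hB hB1 Q).continuousWithinAt (s := Iio t) (x := t)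
  refine le_of_tendsto hc ?_
  filter_upwards [Ioo_mem_nhdsLT ht] with s hs using key s hs

/-- the self-improving property of `star` -/
def StarP {n : ℕ} (p : (Fin n → ℝ) → ℝ) (r K : ℝ) : Prop :=
  ∀ (ι : Type) [Countable ι] (Q : ι → RCube n) (t : ι → ℝ),
    Pairwise (Function.onFun Disjoint fun i => hoSet (Q i)) → (∀ i, 0 < t i) →
    (∀ i, rBad p r K (Q i) (t i)) → ∑' i, modI p (Q i).toSet (t i) ≤ 1 →
    ∑' i, modI p (Q i).toSet (t i) ≤ 1 / 2

theorem starP_one {n : ℕ} {p : (Fin n → ℝ) → ℝ} {r K : ℝ} (H : StarP p r K) (Q : RCube n) {s : ℝ}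
    (hs : 0 < s) (hb : rBad p r K Q s) (h1 : modI p Q.toSet s ≤ 1) : modI p Q.toSet s ≤ 1 / 2 := by
  have := H Unit (fun _ => Q) (fun _ => s) (fun i j hij => absurd (Subsingleton.elim i j) hij)
    (fun _ => hs) (fun _ => hb) (by simpa using h1)
  simpa using this

theorem star_fin {n : ℕ} {p : (Fin n → ℝ) → ℝ} {r K : ℝ} (H : StarP p r K)
    (t : RCube n → ℝ) (S : Finset (RCube n))
    (hd : PairwiseDisjointCubes (S : Set (RCube n))) (ht : ∀ Q ∈ S, 0 < t Q)
    (hb : ∀ Q ∈ S, rBad p r K Q (t Q)) (h1 : ∀ Q ∈ S, modI p Q.toSet (t Q) ≤ 1) :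
    ∑ Q ∈ S, modI p Q.toSet (t Q) ≤ 1 / 2 := by
  classical
  induction S using Finset.induction_on with
  | empty => simp
  | insert Q S hQ ih =>
    have h2 := ih (hd.mono (by simp)) (fun R hR => ht R (by simp [hR]))
      (fun R hR => hb R (by simp [hR])) (fun R hR => h1 R (by simp [hR]))
    have h3 := starP_one H Q (ht Q (by simp)) (hb Q (by simp)) (h1 Q (by simp))
    have h4 : ∑ R ∈ insert Q S, modI p R.toSet (t R) ≤ 1 := by
      rw [Finset.sum_insert hQ]
      refine (add_le_add h3 h2).trans (le_of_eq ?_)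
      rw [one_div]; exact ENNReal.inv_two_add_inv_two
    have h5 := H {R // R ∈ insert Q S} (fun R => R.1) (fun R => t R.1) (by
      intro R R' hRR
      exact (hd R.2 R'.2 (fun h => hRR (Subtype.ext h))).mono (hoSet_subset _) (hoSet_subset _))
      (fun R => ht _ R.2) (fun R => hb _ R.2)
    rw [Finset.tsum_subtype (insert Q S) (fun R => modI p R.toSet (t R))] at h5
    exact h5 h4

/-- the function `b` -/
def bFun {n : ℕ} (p : (Fin n → ℝ) → ℝ) (r K : ℝ) (Q : RCube n) : ℝ≥0∞ :=
  ⨆ (s : ℝ) (_ : 0 < s ∧ modI p Q.toSet s ≤ 1 ∧ rBad p r K Q s), modI p Q.toSet s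

theorem bFun_le {n : ℕ} (p : (Fin n → ℝ) → ℝ) (r K : ℝ) (Q : RCube n) : bFun p r K Q ≤ 1 :=
  iSup₂_le fun _ h => h.2.1

theorem bFun_sum {n : ℕ} {p : (Fin n → ℝ) → ℝ} {r K : ℝ} (H : StarP p r K)
    (F : Set (RCube n)) (hF : PairwiseDisjointCubes F) : ∑' Q : F, bFun p r K Q.1 ≤ 1 := by
  classical
  rw [ENNReal.tsum_eq_iSup_sum]
  refine iSup_le fun S => ?_
  have hpick : ∀ Q : RCube n, bFun p r K Q ≠ 0 → ∃ s, (0 < s ∧ modI p Q.toSet s ≤ 1 ∧ rBad p r K Q s) ∧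
      bFun p r K Q ≤ 2 * modI p Q.toSet s := by
    intro Q hQ
    have hlt : bFun p r K Q / 2 < bFun p r K Q :=
      ENNReal.half_lt_self hQ (ne_top_of_le_ne_top one_ne_top (bFun_le _ _ _ _))
    conv_rhs at hlt => unfold bFun
    obtain ⟨s, hs⟩ := lt_iSup_iff.1 hlt
    obtain ⟨h, hs⟩ := lt_iSup_iff.1 hs
    refine ⟨s, h, ?_⟩
    rw [mul_comm]
    exact (ENNReal.div_le_iff_le_mul (by simp) (by simp)).1 hs.le
  choose! t ht using hpick
  let T : Finset (RCube n) := (S.map (Function.Embedding.subtype _)).filter fun Q => bFun p r K Q ≠ 0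
  have hTb : ∀ Q ∈ T, bFun p r K Q ≠ 0 := fun Q hQ => (Finset.mem_filter.1 hQ).2
  have hTF : (T : Set (RCube n)) ⊆ F := by
    intro Q hQ
    have := (Finset.mem_filter.1 (Finset.mem_coe.1 hQ)).1
    simp only [Finset.mem_map, Function.Embedding.subtype_apply] at this
    obtain ⟨a, -, rfl⟩ := this
    exact a.2
  have hfin := star_fin H t T (hF.mono hTF) (fun Q hQ => (ht Q (hTb Q hQ)).1.1)
    (fun Q hQ => (ht Q (hTb Q hQ)).1.2.2) (fun Q hQ => (ht Q (hTb Q hQ)).1.2.1)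
  calc ∑ Q ∈ S, bFun p r K Q.1 = ∑ Q ∈ S.map (Function.Embedding.subtype _), bFun p r K Q := by
        rw [Finset.sum_map]; rfl
    _ = ∑ Q ∈ T, bFun p r K Q := by
        rw [Finset.sum_filter_ne_zero]
    _ ≤ ∑ Q ∈ T, 2 * modI p Q.toSet (t Q) := Finset.sum_le_sum fun Q hQ => (ht Q (hTb Q hQ)).2
    _ = 2 * ∑ Q ∈ T, modI p Q.toSet (t Q) := by rw [Finset.mul_sum]
    _ ≤ 2 * (1 / 2) := by gcongr
    _ = 1 := by rw [one_div, ENNReal.mul_inv_cancel (by simp) (by simp)]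

theorem params {r K : ℝ} (hr : 1 < r) (hK : 1 ≤ K) {e : ℝ} (he : 0 < e) :
    ∃ M, 1 ≤ M ∧ K * M ^ (1 - r) ≤ 1 / 2 ∧ ∃ τ, 0 < τ ∧ τ < 1 ∧
      K * 2 ^ r * τ ^ e ≤ 1 ∧ 4 * M * K * τ ^ (1 - 1 / r) < 1 := by
  have h1 : Filter.Tendsto (fun M : ℝ => K * M ^ (1 - r)) Filter.atTop (nhds (K * 0)) := by
    have := tendsto_rpow_neg_atTop (y := r - 1) (by linarith)
    simp only [neg_sub] at this
    exact this.const_mul K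
  have h1' := h1.eventually (gt_mem_nhds (show K * 0 < 1 / 2 by norm_num))
  obtain ⟨M, hM1, hM⟩ := ((Filter.eventually_ge_atTop 1).and h1').exists
  have hrr : 0 < 1 - 1 / r := by
    rw [sub_pos, div_lt_one (by linarith)]; exact hr
  have hz : ∀ c a : ℝ, 0 < a → ∀ᶠ τ in nhdsWithin (0:ℝ) (Ioi 0), c * τ ^ a < 1 := by
    intro c a ha
    have : Filter.Tendsto (fun τ : ℝ => c * τ ^ a) (nhds 0) (nhds (c * 0 ^ a)) :=
      (Real.continuousAt_rpow_const 0 a (Or.inr ha.le)).tendsto.const_mul c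
    rw [Real.zero_rpow ha.ne', mul_zero] at this
    exact (this.eventually (gt_mem_nhds one_pos)).filter_mono nhdsWithin_le_nhds
  obtain ⟨τ, ⟨ha, hb⟩, hc⟩ := (((hz (K * 2 ^ r) e he).and (hz (4 * M * K) _ hrr)).and
    (Ioo_mem_nhdsGT one_pos)).exists
  exact ⟨M, hM1, hM.le, τ, hc.1, hc.2, ha.le, hb⟩

theorem pow_swap {t β q : ℝ} (ht : 0 < t) :
    ENNReal.ofReal (t ^ β) ^ q = (ENNReal.ofReal t ^ q) ^ β := by
  rw [← ENNReal.ofReal_rpow_of_pos ht, ← ENNReal.rpow_mul, ← ENNReal.rpow_mul, mul_comm]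

theorem avgM_restr {n : ℕ} (Q : RCube n) (E : Set (Fin n → ℝ)) (hE : MeasurableSet E)
    (f : (Fin n → ℝ) → ℝ≥0∞) :
    ∫⁻ x in Q.toSet \ E, f x ∂avgM Q = (volume Q.toSet)⁻¹ * ∫⁻ x in Q.toSet \ E, f x := by
  rw [avgM, Measure.restrict_smul, lintegral_smul_measure, smul_eq_mul,
    Measure.restrict_restrict ((toSet_meas Q).diff hE), inter_eq_left.2 sdiff_subset]

theorem mainIneq {n : ℕ} {p : (Fin n → ℝ) → ℝ} (hpm : Measurable p) (hp1 : ∀ x, 1 ≤ p x)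
    {B : ℝ} (hB : ∀ᵐ x ∂(volume : Measure (Fin n → ℝ)), p x ≤ B) (hB1 : 1 ≤ B)
    {r K β₀ M τ : ℝ} (hr : 1 < r) (hK : 1 ≤ K) (H : StarP p r K)
    (hβ0 : 0 < β₀) (hβ1 : β₀ < 1) (hrβ : 1 < r * β₀) (hM : 1 ≤ M) (hMK : K * M ^ (1 - r) ≤ 1 / 2)
    (hτ0 : 0 < τ) (hτ1 : τ < 1) (hτa : K * 2 ^ r * τ ^ (r * β₀ - 1) ≤ 1)
    (hτb : 4 * M * K * τ ^ (1 - 1 / r) < 1)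
    (Q : RCube n) (E : Set (Fin n → ℝ)) (hE : MeasurableSet E) (hEQ : E ⊆ Q.toSet)
    (hvol : ENNReal.ofReal (1 - τ) * volume Q.toSet ≤ volume E) {t : ℝ} (ht : 0 < t)
    (hmod : modI p Q.toSet t ≤ 1) :
    modI p Q.toSet t ≤ 2 * (modI p E t +
      (if t < 1 then ENNReal.ofReal (t ^ (1 - β₀)) * bFun p r K Q else 0)) := by
  by_contra! hbad
  have hcont := modI_cont hpm hp1 hB hB1 Q
  have hfin : modI p Q.toSet t ≠ ∞ := ne_top_of_le_ne_top one_ne_top hmod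
  have hEfin : modI p E t ≠ ∞ := ne_top_of_le_ne_top hfin (modI_mono p hEQ t)
  -- the complement of `E`
  have hsplit : modI p Q.toSet t = modI p E t + modI p (Q.toSet \ E) t := by
    have := lintegral_inter_add_sdiff (μ := volume) (fun x => ENNReal.ofReal t ^ p x) Q.toSet hE
    rw [inter_eq_right.2 hEQ] at this
    exact this.symm
  have hb1 : 2 * modI p E t ≤ modI p Q.toSet t :=
    le_trans (by gcongr; exact le_self_add) hbad.le
  have hb2 : modI p Q.toSet t ≤ 2 * modI p (Q.toSet \ E) t := by
    have : modI p E t ≤ modI p (Q.toSet \ E) t := by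
      rw [hsplit, two_mul] at hb1
      exact (ENNReal.add_le_add_iff_left hEfin).1 hb1
    rw [hsplit, two_mul]
    gcongr
  have hFm : avgM Q (Q.toSet \ E) ≤ ENNReal.ofReal τ := by
    have h1 : volume (Q.toSet \ E) ≤ ENNReal.ofReal τ * volume Q.toSet := by
      have hEf : volume E ≠ ∞ := ne_top_of_le_ne_top (volume_toSet_ne_top Q) (measure_mono hEQ)
      rw [measure_sdiff hEQ hE.nullMeasurableSet hEf, tsub_le_iff_right]
      calc volume Q.toSet = ENNReal.ofReal (τ + (1 - τ)) * volume Q.toSet := by simp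
        _ = ENNReal.ofReal τ * volume Q.toSet + ENNReal.ofReal (1 - τ) * volume Q.toSet := by
            rw [ENNReal.ofReal_add hτ0.le (by linarith), add_mul]
        _ ≤ _ := by gcongr
    rw [avgM, Measure.smul_apply, smul_eq_mul, Measure.restrict_apply ((toSet_meas Q).diff hE),
      inter_eq_left.2 sdiff_subset]
    calc _ ≤ (volume Q.toSet)⁻¹ * (ENNReal.ofReal τ * volume Q.toSet) := by gcongr
      _ = ENNReal.ofReal τ * ((volume Q.toSet)⁻¹ * volume Q.toSet) := by ring
      _ = _ := by rw [ENNReal.inv_mul_cancel (volume_toSet_ne_zero Q) (volume_toSet_ne_top Q), mul_one]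
  have hb3 : ∫⁻ x, ENNReal.ofReal t ^ p x ∂avgM Q ≤
      2 * ∫⁻ x in Q.toSet \ E, ENNReal.ofReal t ^ p x ∂avgM Q := by
    rw [avgM_lint, avgM_restr Q E hE, mul_left_comm]
    gcongr
    exact hb2
  by_cases ht1 : t < 1
  · rw [if_pos ht1] at hbad
    have hrb : ∀ β, β₀ ≤ β → β ≤ 1 → rBad p r K Q (t ^ β) := by
      intro β h1 h2
      have := lemJ1 (avgM Q) (rpow_meas hpm (ENNReal.ofReal t)) hβ0 hrβ h1 h2 hK hτ0 hτ1.le hτa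
        (Q.toSet \ E) hFm hb3
      unfold rBad
      have e1 : ∀ x, ENNReal.ofReal (t ^ β) ^ p x = (ENNReal.ofReal t ^ p x) ^ β :=
        fun x => pow_swap ht
      have e2 : ∀ x, (ENNReal.ofReal (t ^ β) ^ p x) ^ r = (ENNReal.ofReal t ^ p x) ^ (r * β) := by
        intro x
        rw [e1 x, ← ENNReal.rpow_mul _ β r, mul_comm β r]
      rw [lintegral_congr e1, lintegral_congr e2]
      exact this
    have hs0 : modI p Q.toSet (t ^ β₀) ≤ 1 := by
      by_contra! hgt
      have hc : ContinuousOn (fun β : ℝ => modI p Q.toSet (t ^ β)) (Icc β₀ 1) := by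
        refine (hcont.comp ?_).continuousOn
        exact Real.continuous_const_rpow ht.ne'
      have := intermediate_value_Icc' hβ1.le hc (show (1:ℝ≥0∞) ∈ _ from
        ⟨by simpa using hmod, hgt.le⟩)
      obtain ⟨β, hβ, h1⟩ := this
      simp only at h1
      have := starP_one H Q (Real.rpow_pos_of_pos ht β) (hrb β hβ.1 hβ.2) h1.le
      rw [h1] at this
      exact absurd this (not_le.2 (by rw [one_div]; exact ENNReal.inv_lt_one.2 (by norm_num)))
    have hb : modI p Q.toSet (t ^ β₀) ≤ bFun p r K Q :=
      le_iSup₂ (f := fun s (_ : 0 < s ∧ modI p Q.toSet s ≤ 1 ∧ rBad p r K Q s) => modI p Q.toSet s)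
        (t ^ β₀) ⟨Real.rpow_pos_of_pos ht _, hs0, hrb β₀ le_rfl hβ1.le⟩
    have hle : modI p Q.toSet t ≤ ENNReal.ofReal (t ^ (1 - β₀)) * bFun p r K Q := by
      have := modI_upper hpm hp1 Q.toSet (m := t ^ (1 - β₀)) (t := t ^ β₀)
        (Real.rpow_pos_of_pos ht _) (Real.rpow_le_one ht.le ht1.le (by linarith))
      rw [← Real.rpow_add ht, sub_add_cancel, Real.rpow_one] at this
      refine this.trans ?_
      gcongr
    refine absurd hbad (not_lt.2 (hle.trans ?_))
    rw [two_mul]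
    exact le_add_self.trans le_self_add
  · push Not at ht1
    obtain ⟨T, hT, hT1⟩ : ∃ T, t ≤ T ∧ modI p Q.toSet T = 1 := by
      let L : ℝ := max t (Q.side ^ n)⁻¹
      have hside : 0 < Q.side ^ n := pow_pos Q.side_pos n
      have hL1 : 1 ≤ L := ht1.trans (le_max_left _ _)
      have hL : 1 ≤ modI p Q.toSet L := by
        calc (1:ℝ≥0∞) = ENNReal.ofReal ((Q.side ^ n)⁻¹ * Q.side ^ n) := by
              rw [inv_mul_cancel₀ hside.ne', ENNReal.ofReal_one]
          _ ≤ ENNReal.ofReal (L * Q.side ^ n) := by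
              apply ENNReal.ofReal_le_ofReal
              gcongr
              exact le_max_right _ _
          _ = ENNReal.ofReal L * volume Q.toSet := by
              rw [volume_toSet, ENNReal.ofReal_mul (by linarith)]
          _ = ∫⁻ x in Q.toSet, ENNReal.ofReal L := by
              rw [lintegral_const, Measure.restrict_apply_univ]
          _ ≤ _ := by
              refine lintegral_mono fun x => ?_
              calc ENNReal.ofReal L = ENNReal.ofReal L ^ (1:ℝ) := by simp
                _ ≤ _ := ENNReal.rpow_le_rpow_of_exponent_le (by simpa using hL1) (hp1 x)
      obtain ⟨T, hT, h1⟩ := intermediate_value_Icc (le_max_left t (Q.side ^ n)⁻¹)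
        hcont.continuousOn (show (1:ℝ≥0∞) ∈ _ from ⟨hmod, hL⟩)
      exact ⟨T, hT.1, h1⟩
    have hT0 : 0 < T := by linarith
    have hnb : ¬ rBad p r K Q T := by
      intro hb
      have := starP_one H Q hT0 hb hT1.le
      rw [hT1] at this
      exact absurd this (not_le.2 (by rw [one_div]; exact ENNReal.inv_lt_one.2 (by norm_num)))
    unfold rBad at hnb
    push Not at hnb
    obtain ⟨θ, hθ0, hθ1, hθ⟩ : ∃ θ : ℝ, 0 ≤ θ ∧ θ ≤ 1 ∧ t = T ^ θ := by
      rcases (ht1.trans hT).eq_or_lt with h | h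
      · exact ⟨1, zero_le_one, le_rfl, by rw [← h]; simp; linarith⟩
      · have hl : 0 < Real.log T := Real.log_pos h
        refine ⟨Real.log t / Real.log T, div_nonneg (Real.log_nonneg ht1) hl.le, ?_, ?_⟩
        · rw [div_le_one hl]; exact Real.log_le_log ht hT
        · rw [Real.rpow_def_of_pos hT0, mul_div_cancel₀ _ hl.ne', Real.exp_log ht]
    have hA : ∫⁻ x, ENNReal.ofReal T ^ p x ∂avgM Q = (volume Q.toSet)⁻¹ := by
      rw [avgM_lint]
      have : ∫⁻ x in Q.toSet, ENNReal.ofReal T ^ p x = 1 := hT1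
      rw [this, mul_one]
    have := lemJ2 (avgM Q) (rpow_meas hpm (ENNReal.ofReal T))
      (fun x => ENNReal.rpow_ne_top_of_nonneg (by linarith [hp1 x]) ofReal_ne_top) hr hθ0 hθ1 hK hτ0
      hM hMK hτb (Q.toSet \ E) hFm (by rw [hA]; exact ENNReal.inv_ne_zero.2 (volume_toSet_ne_top Q))
      (by rw [hA]; exact ENNReal.inv_ne_top.2 (volume_toSet_ne_zero Q)) hnb.le
    apply this
    simp only [hθ, pow_swap hT0] at hb3
    exact hb3

theorem final {n : ℕ} (p : (Fin n → ℝ) → ℝ) (hpm : Measurable p)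
    (hp1 : ∀ x, 1 ≤ p x)
    (hup : ∃ B : ℝ, ∀ᵐ x ∂(volume : Measure (Fin n → ℝ)), p x ≤ B)
    (hA : AInfty p) :
    ∃ η ∈ Ioo (0 : ℝ) 1, ∃ δ ∈ Ioo (0 : ℝ) 1, ∃ b : RCube n → ℝ≥0∞,
      (∀ Q : RCube n, b Q ≤ 1) ∧
      (∀ F : Set (RCube n), PairwiseDisjointCubes F → (∑' Q : F, b Q.1) ≤ 1) ∧
      ∀ Q : RCube n, ∀ E : Set (Fin n → ℝ), MeasurableSet E → E ⊆ Q.toSet →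
        ENNReal.ofReal η * volume Q.toSet ≤ volume E →
        ∀ t : ℝ, 0 < t → ENNReal.ofReal t ≤ (vnorm p (chiE Q.toSet))⁻¹ →
          (∫⁻ x in Q.toSet, ENNReal.ofReal t ^ p x) ≤
            2 * ((∫⁻ x in E, ENNReal.ofReal t ^ p x) +
              (if t < 1 then ENNReal.ofReal (t ^ δ) * b Q else 0)) := by
  obtain ⟨B₀, hB₀⟩ := hup
  have hB : ∀ᵐ x ∂(volume : Measure (Fin n → ℝ)), p x ≤ max B₀ 1 := by
    filter_upwards [hB₀] with x hx using hx.trans (le_max_left _ _)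
  have hB1 : 1 ≤ max B₀ 1 := le_max_right _ _
  obtain ⟨r, hr, K, hK, H⟩ := star hpm hp1 hB1 hB hA
  have hr0 : 0 < r := by linarith
  have hi : 1 / r < 1 := by rw [div_lt_one hr0]; exact hr
  have hi0 : 0 < 1 / r := by positivity
  have hir : r * (1 / r) = 1 := by field_simp
  let β₀ : ℝ := (1 + 1 / r) / 2
  have hβ0 : 0 < β₀ := by simp only [β₀]; linarith
  have hβ1 : β₀ < 1 := by simp only [β₀]; linarith
  have hrβ : 1 < r * β₀ := by
    have : r * β₀ = (r + 1) / 2 := by simp only [β₀]; linear_combination hir / 2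
    rw [this]; linarith
  obtain ⟨M, hM, hMK, τ, hτ0, hτ1, hτa, hτb⟩ := params hr hK (e := r * β₀ - 1) (by linarith)
  refine ⟨1 - τ, ⟨by linarith, by linarith⟩, 1 - β₀, ⟨by linarith, by linarith⟩, bFun p r K,
    bFun_le p r K, fun F hF => bFun_sum H F hF, ?_⟩
  intro Q E hE hEQ hvol t ht hle
  exact mainIneq hpm hp1 hB hB1 hr hK H hβ0 hβ1 hrβ hM hMK hτ0 hτ1 hτa hτb Q E hE hEQ hvol ht
    (modI_le_one hpm hp1 hB hB1 Q ht hle)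

theorem statement4 {n : ℕ} (p : (Fin n → ℝ) → ℝ) (hpm : Measurable p)
    (hp1 : ∀ x, 1 ≤ p x)
    (hup : ∃ B : ℝ, ∀ᵐ x ∂(volume : Measure (Fin n → ℝ)), p x ≤ B)
    (hA : AInfty p) :
    ∃ η ∈ Ioo (0 : ℝ) 1, ∃ δ ∈ Ioo (0 : ℝ) 1, ∃ b : RCube n → ℝ≥0∞,
      (∀ Q : RCube n, b Q ≤ 1) ∧
      (∀ F : Set (RCube n), PairwiseDisjointCubes F → (∑' Q : F, b Q.1) ≤ 1) ∧
      ∀ Q : RCube n, ∀ E : Set (Fin n → ℝ), MeasurableSet E → E ⊆ Q.toSet →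
        ENNReal.ofReal η * volume Q.toSet ≤ volume E →
        ∀ t : ℝ, 0 < t → ENNReal.ofReal t ≤ (vnorm p (chiE Q.toSet))⁻¹ →
          (∫⁻ x in Q.toSet, ENNReal.ofReal t ^ p x) ≤
            2 * ((∫⁻ x in E, ENNReal.ofReal t ^ p x) +
              (if t < 1 then ENNReal.ofReal (t ^ δ) * b Q else 0)) := by
  exact final p hpm hp1 hup hA
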